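/- arXiv:2412.21120 — 4 statements merged into one kernel-verified Lean document; each statement's English description precedes it below -/
import Mathlib

section
/- If the pivot complex T_{i_1,…,i_l} is a resolution of Q/I, then it admits the structure of a DG-algebra over Q: there is a Q-bilinear multiplication ⋆ on T_{i_1,…,i_l} with (T_{i_1,…,i_l})_a ⋆ (T_{i_1,…,i_l})_b ⊆ (T_{i_1,…,i_l})_{a+b}, with unit ε_∅ (so ε_∅ ⋆ x = x ⋆ ε_∅ = x), which is graded-commutative (x ⋆ y = (−1)^{|x||y|} y ⋆ x for homogeneous x, y, and x ⋆ x = 0 when |x| is odd), associative, and satisfies the Leibniz rule ∂(x ⋆ y) = ∂(x) ⋆ y + (−1)^{|x|} x ⋆ ∂(y) for homogeneous x, y. -/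
open MvPolynomial Finset

noncomputable section

/-- `fsign A B` is `0` if `A ∩ B ≠ ∅`, and otherwise `(−1)^{p(A,B)}` where `p(A,B)`
is the number of pairs `(a,b) ∈ A × B` with `a > b`. -/
def fsign {α : Type*} [LinearOrder α] [DecidableEq α] (A B : Finset α) : ℤ :=
  if A ∩ B = ∅ then (-1 : ℤ) ^ (((A ×ˢ B).filter fun p => p.2 < p.1).card) else 0

/-- The total module underlying the Taylor complex: free over `Q = k[x_1,…,x_n]`
with basis `ε_τ` indexed by all subsets `τ ⊆ [q]`. -/
abbrev TotMod (k : Type*) [Field k] (n q : ℕ) : Type _ :=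
  Finset (Fin q) →₀ MvPolynomial (Fin n) k

/-- `m_τ = lcm{m_i : i ∈ τ}`, where `m_i` is the monomial with exponent vector `D i`. -/
def lcmMono (k : Type*) [Field k] (n q : ℕ) (D : Fin q → (Fin n →₀ ℕ))
    (τ : Finset (Fin q)) : MvPolynomial (Fin n) k :=
  monomial (τ.sup D) (1 : k)

/-- The monomial ideal `I = (m_1, …, m_q)`. -/
def monIdeal (k : Type*) [Field k] (n q : ℕ) (D : Fin q → (Fin n →₀ ℕ)) :
    Ideal (MvPolynomial (Fin n) k) :=
  Ideal.span (Set.range fun i => monomial (D i) (1 : k))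

/-- The Taylor differential `∂(ε_τ) = Σ_{j∈τ} sign(j, τ∖{j}) (m_τ/m_{τ∖{j}}) ε_{τ∖{j}}`,
as a linear endomorphism of the total module. -/
def taylorD (k : Type*) [Field k] (n q : ℕ) (D : Fin q → (Fin n →₀ ℕ)) :
    TotMod k n q →ₗ[MvPolynomial (Fin n) k] TotMod k n q :=
  Finsupp.linearCombination _ fun τ =>
    ∑ j ∈ τ, Finsupp.single (τ \ {j})
      ((fsign {j} (τ \ {j}) : MvPolynomial (Fin n) k) *
        monomial (τ.sup D - (τ \ {j}).sup D) (1 : k))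

/-- The degree-`i` piece of the subcomplex of the Taylor complex spanned by the
`ε_τ` with `τ ∈ Ω`: the free submodule with basis `{ε_τ : τ ∈ Ω, |τ| = i}`. -/
def piece (k : Type*) [Field k] (n q : ℕ) (Ω : Set (Finset (Fin q))) (i : ℕ) :
    Submodule (MvPolynomial (Fin n) k) (TotMod k n q) :=
  Finsupp.supported _ _ {τ | τ ∈ Ω ∧ τ.card = i}

/-- The subcomplex of the Taylor complex spanned by all `ε_τ` with `τ ∈ Ω`. -/
def subcx (k : Type*) [Field k] (n q : ℕ) (Ω : Set (Finset (Fin q))) :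
    Submodule (MvPolynomial (Fin n) k) (TotMod k n q) :=
  Finsupp.supported _ _ Ω

/-- The index family of the pivot complex `T_S`: all `τ` with `τ ⊉ S`. -/
def pivotΩ {q : ℕ} (S : Finset (Fin q)) : Set (Finset (Fin q)) := {τ | ¬ S ⊆ τ}

/-- The subcomplex of the Taylor complex spanned by `{ε_τ : τ ∈ Ω}` is a resolution
of `Q/I`: it is exact in homological degrees `≥ 1`, and its zeroth homology is
identified with `Q/I` via the augmentation `ε_∅ ↦ 1`. -/
def IsResolutionOf (k : Type*) [Field k] (n q : ℕ) (D : Fin q → (Fin n →₀ ℕ))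
    (Ω : Set (Finset (Fin q))) : Prop :=
  (∀ i : ℕ, ∀ x ∈ piece k n q Ω (i + 1), taylorD k n q D x = 0 →
      ∃ y ∈ piece k n q Ω (i + 2), taylorD k n q D y = x) ∧
  (∀ x ∈ piece k n q Ω 0,
      (x (∅ : Finset (Fin q)) ∈ monIdeal k n q D ↔
        ∃ y ∈ piece k n q Ω 1, taylorD k n q D y = x))

/-- The Scarf set of `I`: all `t` such that there are two distinct subsets
`τ ≠ τ'` of `[q]` with `|τ| = t` and `m_τ = m_{τ'}`.  The Scarf number of `I`
is `sInf` of this set; `scarf(I) = ∞` corresponds to this set being empty. -/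
def scarfSet (k : Type*) [Field k] (n q : ℕ) (D : Fin q → (Fin n →₀ ℕ)) : Set ℕ :=
  {t | ∃ τ τ' : Finset (Fin q), τ ≠ τ' ∧ τ.card = t ∧
        lcmMono k n q D τ = lcmMono k n q D τ'}

end

namespace Piv

section signs
variable {q : ℕ}

def sg (a b : Fin q) : ℤ := if a = b then 0 else if b < a then -1 else 1

lemma sg_swap (a b : Fin q) : sg a b = - sg b a := by
  unfold sg
  rcases lt_trichotomy a b with h | h | h
  · simp [h, h.ne, h.ne', h.not_gt]
  · simp [h]
  · simp [h, h.ne, h.ne', h.not_gt]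

lemma sg_sq {a b : Fin q} (h : a ≠ b) : sg a b * sg a b = 1 := by
  unfold sg
  rw [if_neg h]; split_ifs <;> simp

lemma fsign_eq (A B : Finset (Fin q)) : fsign A B = ∏ a ∈ A, ∏ b ∈ B, sg a b := by
  unfold fsign
  split_ifs with h
  · rw [← Finset.prod_product', ← Finset.prod_const, Finset.prod_filter]
    refine Finset.prod_congr rfl ?_
    rintro ⟨a, b⟩ hab
    have hab' := Finset.mem_product.1 hab
    have : a ≠ b := by
      rintro rfl
      have : a ∈ A ∩ B := Finset.mem_inter.2 hab'
      rw [h] at this; simp at this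
    simp [sg, this]
  · obtain ⟨a, ha⟩ := Finset.nonempty_iff_ne_empty.2 h
    rw [Finset.mem_inter] at ha
    symm
    refine Finset.prod_eq_zero ha.1 (Finset.prod_eq_zero ha.2 ?_)
    simp [sg]

lemma fsign_union_left {A B : Finset (Fin q)} (C : Finset (Fin q)) (h : Disjoint A B) :
    fsign (A ∪ B) C = fsign A C * fsign B C := by
  simp only [fsign_eq, Finset.prod_union h]

lemma fsign_union_right {B C : Finset (Fin q)} (A : Finset (Fin q)) (h : Disjoint B C) :
    fsign A (B ∪ C) = fsign A B * fsign A C := by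
  simp only [fsign_eq, Finset.prod_union h, Finset.prod_mul_distrib]

lemma fsign_zero {A B : Finset (Fin q)} (h : ¬ Disjoint A B) : fsign A B = 0 := by
  unfold fsign
  rw [if_neg]
  rwa [← Finset.disjoint_iff_inter_eq_empty]

lemma fsign_sq {A B : Finset (Fin q)} (h : Disjoint A B) : fsign A B * fsign A B = 1 := by
  unfold fsign
  rw [if_pos (Finset.disjoint_iff_inter_eq_empty.1 h), ← mul_pow]; simp

lemma fsign_comm (A B : Finset (Fin q)) :
    fsign A B = (-1) ^ (A.card * B.card) * fsign B A := by
  rw [fsign_eq, fsign_eq, Finset.prod_comm (s := B)]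
  have h : ∀ a ∈ A, ∏ b ∈ B, sg a b = (-1) ^ B.card * ∏ b ∈ B, sg b a := by
    intro a _
    rw [← Finset.prod_const, ← Finset.prod_mul_distrib]
    exact Finset.prod_congr rfl fun b _ => by rw [sg_swap a b]; ring
  rw [Finset.prod_congr rfl h, Finset.prod_mul_distrib, Finset.prod_const, ← pow_mul,
    mul_comm A.card]

lemma fsign_assoc (A B C : Finset (Fin q)) :
    fsign A B * fsign (A ∪ B) C = fsign B C * fsign A (B ∪ C) := by
  by_cases h1 : Disjoint A B
  · by_cases h2 : Disjoint B C
    · rw [fsign_union_left _ h1, fsign_union_right _ h2]; ring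
    · rw [fsign_zero h2, fsign_zero (A := A ∪ B)]
      · simp
      · intro h; exact h2 (Finset.disjoint_union_left.1 h).2
  · rw [fsign_zero h1, fsign_zero (B := B ∪ C)]
    · simp
    · intro h; exact h1 (Finset.disjoint_union_right.1 h).1

lemma fsign_single (i j : Fin q) : fsign {i} {j} = sg i j := by simp [fsign_eq]

@[simp] lemma fsign_empty_left (A : Finset (Fin q)) : fsign ∅ A = 1 := by simp [fsign_eq]
@[simp] lemma fsign_empty_right (A : Finset (Fin q)) : fsign A ∅ = 1 := by simp [fsign_eq]

end signs

section ext
variable {q : ℕ} {R : Type*} [CommRing R]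

variable (q R) in
abbrev E := Finset (Fin q) →₀ R

noncomputable abbrev e (τ : Finset (Fin q)) : E q R := Finsupp.single τ 1

lemma hom_ext {M : Type*} [AddCommGroup M] [Module R M] {f g : E q R →ₗ[R] M}
    (h : ∀ τ, f (e τ) = g (e τ)) : f = g := Finsupp.lhom_ext' fun τ => LinearMap.ext_ring (h τ)

variable (q R) in
noncomputable def W : E q R →ₗ[R] E q R →ₗ[R] E q R :=
  Finsupp.linearCombination R fun σ => Finsupp.linearCombination R fun τ =>
    (fsign σ τ : R) • e (σ ∪ τ)

lemma W_e (σ τ : Finset (Fin q)) : W q R (e σ) (e τ) = (fsign σ τ : R) • e (σ ∪ τ) := by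
  simp [W]

variable (q R) in
noncomputable def d : E q R →ₗ[R] E q R :=
  Finsupp.linearCombination R fun τ => ∑ j ∈ τ, (fsign {j} (τ \ {j}) : R) • e (τ \ {j})

lemma d_e (τ : Finset (Fin q)) :
    d q R (e τ) = ∑ j ∈ τ, (fsign {j} (τ \ {j}) : R) • e (τ \ {j}) := by simp [d]

variable (q R) in
noncomputable def s : E q R →ₗ[R] E q R :=
  Finsupp.linearCombination R fun τ => ((-1 : R) ^ τ.card) • e τ

lemma s_e (τ : Finset (Fin q)) : s q R (e τ) = ((-1 : R) ^ τ.card) • e τ := by simp [s]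

open Classical in
variable (R) in
noncomputable def P (S : Finset (Fin q)) : E q R →ₗ[R] E q R :=
  Finsupp.linearCombination R fun τ => if S ⊆ τ then e τ else 0

lemma P_e_pos {S τ : Finset (Fin q)} (h : S ⊆ τ) : P R S (e τ) = e τ := by simp [P, h]
lemma P_e_neg {S τ : Finset (Fin q)} (h : ¬ S ⊆ τ) : P R S (e τ) = 0 := by simp [P, h]

lemma W_empty_left (x : E q R) : W q R (e ∅) x = x := by
  have : W q R (e ∅) = LinearMap.id := hom_ext fun τ => by rw [W_e]; simp
  rw [this]; rfl

lemma W_empty_right (x : E q R) : W q R x (e ∅) = x := by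
  have : (W q R).flip (e ∅) = LinearMap.id := hom_ext fun τ => by
    rw [LinearMap.flip_apply, W_e]; simp
  exact LinearMap.congr_fun this x

lemma W_assoc (x y z : E q R) : W q R (W q R x y) z = W q R x (W q R y z) := by
  induction x using Finsupp.induction_linear with
  | zero => simp
  | add f g hf hg => simp [hf, hg]
  | single A a =>
  induction y using Finsupp.induction_linear with
  | zero => simp
  | add f g hf hg => simp [hf, hg]
  | single B b =>
  induction z using Finsupp.induction_linear with
  | zero => simp
  | add f g hf hg => simp [hf, hg]
  | single C c =>
  have key : W q R (W q R (e A) (e B)) (e C) = W q R (e A) (W q R (e B) (e C)) := by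
    rw [W_e, W_e]
    simp only [map_smul, LinearMap.smul_apply, W_e, smul_smul, Finset.union_assoc]
    congr 1
    exact_mod_cast congrArg (Int.cast : ℤ → R) (fsign_assoc A B C)
  have hs : ∀ (T : Finset (Fin q)) (t : R), Finsupp.single T t = t • (e T : E q R) := by
    intro T t; simp
  rw [hs A, hs B, hs C]
  simp only [map_smul, LinearMap.smul_apply, key]

noncomputable abbrev ej (j : Fin q) : E q R := e {j}

lemma sub_top (N : Submodule R (E q R)) (h0 : e ∅ ∈ N)
    (h1 : ∀ j, ∀ x ∈ N, W q R (ej j) x ∈ N) : ∀ x, x ∈ N := by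
  have hb : ∀ τ, (e τ : E q R) ∈ N := by
    intro τ
    induction τ using Finset.induction_on with
    | empty => exact h0
    | insert j A hj ih =>
      have hd : Disjoint {j} A := by simpa using hj
      have h2 := N.smul_mem (fsign {j} A : R) (h1 j _ ih)
      rw [W_e, smul_smul] at h2
      have h3 : (fsign {j} A : R) * (fsign {j} A : R) = 1 := by
        exact_mod_cast congrArg (Int.cast : ℤ → R) (fsign_sq hd)
      rw [h3, one_smul] at h2
      exact h2
  intro x
  induction x using Finsupp.induction_linear with
  | zero => exact N.zero_mem
  | add f g hf hg => exact N.add_mem hf hg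
  | single A a =>
    have := N.smul_mem a (hb A)
    simpa using this

lemma ej_anti (i j : Fin q) (x : E q R) :
    W q R (ej i) (W q R (ej j) x) = - W q R (ej j) (W q R (ej i) x) := by
  rw [← W_assoc, ← W_assoc, W_e, W_e, fsign_single, fsign_single, sg_swap, Finset.union_comm]
  simp

lemma ej_sq (i : Fin q) (x : E q R) : W q R (ej i) (W q R (ej i) x) = 0 := by
  rw [← W_assoc, W_e, fsign_single]; simp [sg]

lemma cast_mul_eq {a b c f : ℤ} (h : a * b = c * f) : (a : R) * b = c * f := by
  exact_mod_cast congrArg (Int.cast : ℤ → R) h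

lemma d_ej (j : Fin q) (x : E q R) :
    d q R (W q R (ej j) x) = x - W q R (ej j) (d q R x) := by
  have : (d q R) ∘ₗ (W q R (ej j)) = LinearMap.id - (W q R (ej j)) ∘ₗ (d q R) := by
    refine hom_ext fun τ => ?_
    simp only [LinearMap.comp_apply, LinearMap.sub_apply, LinearMap.id_apply]
    rw [W_e, d_e, map_smul, d_e, map_sum]
    simp only [map_smul, W_e, smul_smul]
    by_cases hj : j ∈ τ
    · rw [fsign_zero (by simpa using hj), Finset.sum_eq_single_of_mem j hj]
      · have h1 : {j} ∪ τ \ {j} = τ := by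
          ext a; by_cases a = j <;> simp_all
        have h2 := fsign_sq (A := {j}) (B := τ \ {j}) Finset.disjoint_sdiff
        rw [h1, ← Int.cast_mul, h2]; simp
      · intro i hi hij
        rw [fsign_zero (A := {j})]; · simp
        simp [hj, hij.symm]
    · have hd : Disjoint {j} τ := by simpa using hj
      rw [Finset.sum_union hd, Finset.sum_singleton, smul_add, sub_eq_add_neg]
      congr 1
      · have h1 : ({j} ∪ τ) \ {j} = τ := by
          ext a; by_cases a = j <;> simp_all
        rw [h1, smul_smul, ← Int.cast_mul, fsign_sq hd]; simp
      · rw [Finset.smul_sum, ← Finset.sum_neg_distrib]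
        refine Finset.sum_congr rfl fun i hi => ?_
        have hij : i ≠ j := by rintro rfl; exact hj hi
        have h1 : ({j} ∪ τ) \ {i} = {j} ∪ τ \ {i} := by
          ext a; by_cases a = j <;> simp_all [Ne.symm]
        have hd2 : Disjoint {j} (τ \ {i}) := by simp [hj]
        have h2 : τ = {i} ∪ τ \ {i} := by
          ext a; by_cases a = i <;> simp_all
        have h3 : fsign {j} τ = sg j i * fsign {j} (τ \ {i}) := by
          conv_lhs => rw [h2]
          rw [fsign_union_right _ Finset.disjoint_sdiff, fsign_single]
        rw [h1, smul_smul, fsign_union_right _ hd2, h3, fsign_single, ← neg_smul]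
        congr 1
        rw [← Int.cast_mul, ← Int.cast_mul, ← Int.cast_neg]
        congr 1
        have h4 := sg_sq hij
        rw [sg_swap j i]
        linear_combination (-fsign {j} (τ \ {i}) * fsign {i} (τ \ {i})) * h4
  exact LinearMap.congr_fun this x

lemma d_empty : d q R (e ∅) = 0 := by rw [d_e]; simp
lemma s_empty : s q R (e ∅) = e ∅ := by rw [s_e]; simp

lemma d_d (x : E q R) : d q R (d q R x) = 0 := by
  refine sub_top (LinearMap.ker (d q R ∘ₗ d q R)) ?_ ?_ x
  · simp [d_empty]
  · intro j x hx
    simp only [LinearMap.mem_ker, LinearMap.comp_apply] at hx ⊢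
    rw [d_ej, map_sub, d_ej, hx]; simp

lemma s_ej (j : Fin q) (x : E q R) :
    s q R (W q R (ej j) x) = - W q R (ej j) (s q R x) := by
  have : (s q R) ∘ₗ (W q R (ej j)) = - (W q R (ej j)) ∘ₗ (s q R) := by
    refine hom_ext fun τ => ?_
    simp only [LinearMap.comp_apply, LinearMap.neg_apply]
    rw [W_e, s_e, map_smul, map_smul, s_e, W_e]
    by_cases hj : j ∈ τ
    · rw [fsign_zero (by simpa using hj)]; simp
    · rw [Finset.card_union_of_disjoint (by simpa using hj), smul_smul, smul_smul, ← neg_smul]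
      congr 1
      simp [pow_add]; ring
  exact LinearMap.congr_fun this x

lemma leib (x y : E q R) :
    d q R (W q R x y) = W q R (d q R x) y + W q R (s q R x) (d q R y) := by
  have : x ∈ LinearMap.eqLocus ((LinearMap.compRight R (d q R)) ∘ₗ W q R) (W q R ∘ₗ d q R +
      (LinearMap.lcomp R _ (d q R)) ∘ₗ (W q R ∘ₗ s q R)) := by
    refine sub_top _ ?_ ?_ x
    · rw [LinearMap.mem_eqLocus]; refine LinearMap.ext fun y => ?_
      change d q R (W q R (e ∅) y) = W q R (d q R (e ∅)) y + W q R (s q R (e ∅)) (d q R y)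
      rw [d_empty, s_empty, W_empty_left, W_empty_left]; simp
    · intro j x hx
      rw [LinearMap.mem_eqLocus] at hx ⊢
      refine LinearMap.ext fun y => ?_
      have h : d q R (W q R x y) = W q R (d q R x) y + W q R (s q R x) (d q R y) :=
        LinearMap.congr_fun hx y
      change d q R (W q R (W q R (ej j) x) y) = W q R (d q R (W q R (ej j) x)) y +
        W q R (s q R (W q R (ej j) x)) (d q R y)
      rw [W_assoc, d_ej, h, d_ej, s_ej]
      simp only [map_sub, map_add, map_neg, LinearMap.sub_apply, LinearMap.neg_apply, W_assoc]
      abel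
  rw [LinearMap.mem_eqLocus] at this
  exact LinearMap.congr_fun this y

lemma W_ej_right (z : E q R) (p : Fin q) : W q R z (ej p) = W q R (ej p) (s q R z) := by
  have h : z ∈ LinearMap.ker ((W q R).flip (ej p) - W q R (ej p) ∘ₗ s q R) := by
    refine sub_top _ ?_ ?_ z
    · simp [W_empty_left, W_empty_right, s_empty]
    · intro j x hx
      simp only [LinearMap.mem_ker, LinearMap.sub_apply, LinearMap.comp_apply,
        LinearMap.flip_apply, sub_eq_zero] at hx ⊢
      rw [W_assoc, hx, s_ej, map_neg, ej_anti]
  simpa only [LinearMap.mem_ker, LinearMap.sub_apply, LinearMap.comp_apply,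
        LinearMap.flip_apply, sub_eq_zero] using h

lemma s_s (z : E q R) : s q R (s q R z) = z := by
  have : s q R ∘ₗ s q R = LinearMap.id := hom_ext fun τ => by
    simp only [LinearMap.comp_apply, s_e, map_smul, smul_smul, ← mul_pow]; simp
  exact LinearMap.congr_fun this z

variable (S : Finset (Fin q)) {p : Fin q}

lemma P_P (x : E q R) : P R S (P R S x) = P R S x := by
  have : P R S ∘ₗ P R S = P R S := hom_ext fun τ => by
    by_cases h : S ⊆ τ <;> simp [P_e_pos, P_e_neg, h]
  exact LinearMap.congr_fun this x

lemma P_s (x : E q R) : s q R (P R S x) = P R S (s q R x) := by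
  have : s q R ∘ₗ P R S = P R S ∘ₗ s q R := hom_ext fun τ => by
    simp only [LinearMap.comp_apply]
    rw [s_e, map_smul]
    by_cases h : S ⊆ τ
    · rw [P_e_pos h, s_e]
    · rw [P_e_neg h]; simp
  exact LinearMap.congr_fun this x

lemma P_ej (hp : p ∉ S) (x : E q R) : P R S (W q R (ej p) x) = W q R (ej p) (P R S x) := by
  have : P R S ∘ₗ W q R (ej p) = W q R (ej p) ∘ₗ P R S := hom_ext fun τ => by
    simp only [LinearMap.comp_apply]
    rw [W_e, map_smul]
    have h1 : S ⊆ {p} ∪ τ ↔ S ⊆ τ := by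
      constructor
      · intro h a ha
        have := h ha
        rw [Finset.mem_union, Finset.mem_singleton] at this
        rcases this with rfl | h2
        · exact absurd ha hp
        · exact h2
      · intro h; exact h.trans Finset.subset_union_right
    by_cases h : S ⊆ τ
    · rw [P_e_pos h, P_e_pos (h1.2 h), W_e]
    · rw [P_e_neg h, P_e_neg (fun h' => h (h1.1 h'))]; simp
  exact LinearMap.congr_fun this x

lemma P_d_P (x : E q R) : P R S (d q R (P R S x)) = P R S (d q R x) := by
  have : P R S ∘ₗ d q R ∘ₗ P R S = P R S ∘ₗ d q R := hom_ext fun τ => by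
    simp only [LinearMap.comp_apply]
    by_cases h : S ⊆ τ
    · rw [P_e_pos h]
    · rw [P_e_neg h, d_e]
      simp only [map_zero, map_sum, map_smul]
      symm
      refine Finset.sum_eq_zero fun j _ => ?_
      rw [P_e_neg (fun h' => h (h'.trans Finset.sdiff_subset))]; simp
  exact LinearMap.congr_fun this x

lemma P_W_left (x y : E q R) : P R S (W q R (P R S x) y) = W q R (P R S x) y := by
  have : (LinearMap.compRight R (P R S)) ∘ₗ W q R ∘ₗ P R S = W q R ∘ₗ P R S :=
    hom_ext fun σ => hom_ext fun τ => by
      change P R S (W q R (P R S (e σ)) (e τ)) = W q R (P R S (e σ)) (e τ)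
      by_cases h : S ⊆ σ
      · rw [P_e_pos h, W_e, map_smul, P_e_pos (h.trans Finset.subset_union_left)]
      · rw [P_e_neg h]; simp
  exact LinearMap.congr_fun (LinearMap.congr_fun this x) y

lemma P_W_right (x y : E q R) : P R S (W q R y (P R S x)) = W q R y (P R S x) := by
  have : (LinearMap.compRight R (P R S)) ∘ₗ (W q R).flip ∘ₗ P R S = (W q R).flip ∘ₗ P R S :=
    hom_ext fun σ => hom_ext fun τ => by
      change P R S (W q R (e τ) (P R S (e σ))) = W q R (e τ) (P R S (e σ))
      by_cases h : S ⊆ σ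
      · rw [P_e_pos h, W_e, map_smul, P_e_pos (h.trans Finset.subset_union_right)]
      · rw [P_e_neg h]; simp
  exact LinearMap.congr_fun (LinearMap.congr_fun this x) y

variable (R) (p) in
noncomputable def hh : E q R →ₗ[R] E q R := W q R (ej p) ∘ₗ P R S

lemma hh_apply (x : E q R) : hh R S p x = W q R (ej p) (P R S x) := rfl

lemma hh_e (τ : Finset (Fin q)) (h : S ⊆ τ) : hh R S p (e τ) = (fsign {p} τ : R) • e ({p} ∪ τ) := by
  rw [hh_apply, P_e_pos h, W_e]

lemma hh_ej (hp : p ∉ S) (x : E q R) : hh R S p (W q R (ej p) x) = 0 := by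
  rw [hh_apply, P_ej S hp, ej_sq]

lemma hh_hh (hp : p ∉ S) (x : E q R) : hh R S p (hh R S p x) = 0 := hh_ej S hp _

lemma hh_d_hh (hp : p ∉ S) (x : E q R) : hh R S p (d q R (hh R S p x)) = hh R S p x := by
  rw [hh_apply S x, d_ej, map_sub, hh_ej S hp, hh_apply, P_P]; simp

variable (R) (p) in
noncomputable def pr : E q R →ₗ[R] E q R := LinearMap.id - d q R ∘ₗ hh R S p - hh R S p ∘ₗ d q R

lemma pr_apply (x : E q R) : pr R S p x = x - d q R (hh R S p x) - hh R S p (d q R x) := rfl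

lemma d_pr (x : E q R) : d q R (pr R S p x) = pr R S p (d q R x) := by
  simp [pr_apply, d_d]

lemma pr_hh (hp : p ∉ S) (x : E q R) : pr R S p (hh R S p x) = 0 := by
  rw [pr_apply, hh_hh S hp, hh_d_hh S hp]; simp

lemma hh_pr (hp : p ∉ S) (x : E q R) : hh R S p (pr R S p x) = 0 := by
  rw [pr_apply, map_sub, map_sub, hh_hh S hp, hh_d_hh S hp]; simp

lemma P_pr (hp : p ∉ S) (x : E q R) : P R S (pr R S p x) = 0 := by
  set w := pr R S p x with hw
  have h1 : W q R (ej p) (P R S w) = 0 := hh_pr S hp x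
  have h2 : W q R (ej p) (P R S (d q R w)) = 0 := by
    rw [hw, d_pr]; exact hh_pr S hp _
  have h3 := d_ej p (P R S w)
  rw [h1, map_zero] at h3
  have h4 : P R S w = W q R (ej p) (d q R (P R S w)) := (sub_eq_zero.1 h3.symm)
  have h5 := congrArg (P R S) h4
  rw [P_P, P_ej S hp, P_d_P, h2] at h5
  exact h5

lemma pr_of (x : E q R) (hx : P R S x = 0) : pr R S p x = x := by
  have h := P_d_P S x
  rw [hx] at h
  rw [pr_apply, hh_apply, hh_apply, hx, ← h]; simp

lemma pr_hh_W (hp : p ∉ S) (b z : E q R) : pr R S p (W q R (hh R S p b) z) = 0 := by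
  rw [hh_apply, W_assoc, ← P_W_left]
  exact pr_hh S hp _

lemma pr_W_hh (hp : p ∉ S) (b z : E q R) : pr R S p (W q R z (hh R S p b)) = 0 := by
  rw [hh_apply, ← W_assoc, W_ej_right, W_assoc, ← P_W_right]
  exact pr_hh S hp _

lemma s_hh (b : E q R) : s q R (hh R S p b) = hh R S p (- s q R b) := by
  rw [hh_apply, s_ej, P_s, hh_apply]; simp

lemma pr_W_pr_left (hp : p ∉ S) (w z : E q R) :
    pr R S p (W q R (pr R S p w) z) = pr R S p (W q R w z) := by
  have h1 : W q R (d q R (hh R S p w)) z = d q R (W q R (hh R S p w) z) -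
      W q R (s q R (hh R S p w)) (d q R z) := by rw [leib]; abel
  rw [pr_apply S w, map_sub, map_sub, LinearMap.sub_apply, LinearMap.sub_apply, map_sub, map_sub,
    pr_hh_W S hp, h1, map_sub, ← d_pr, pr_hh_W S hp, s_hh, pr_hh_W S hp]
  simp

lemma pr_W_pr_right (hp : p ∉ S) (w z : E q R) :
    pr R S p (W q R z (pr R S p w)) = pr R S p (W q R z w) := by
  have h1 : W q R z (d q R (hh R S p w)) = d q R (W q R (s q R z) (hh R S p w)) -
      W q R (d q R (s q R z)) (hh R S p w) := by rw [leib, s_s]; abel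
  rw [pr_apply S w, map_sub, map_sub, map_sub, map_sub,
    pr_W_hh S hp, h1, map_sub, ← d_pr, pr_W_hh S hp, pr_W_hh S hp]
  simp

lemma supp_le {Ω : Set (Finset (Fin q))} {N : Submodule R (E q R)}
    (h : ∀ τ ∈ Ω, (e τ : E q R) ∈ N) : Finsupp.supported R R Ω ≤ N := by
  rw [Finsupp.supported_eq_span_single, Submodule.span_le]
  rintro _ ⟨τ, hτ, rfl⟩
  exact h τ hτ

variable (q R) in
noncomputable def H (i : ℕ) : Submodule R (E q R) := Finsupp.supported R R {τ | τ.card = i}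

lemma e_H (τ : Finset (Fin q)) : (e τ : E q R) ∈ H q R τ.card :=
  Finsupp.single_mem_supported R 1 rfl

lemma H_le {i : ℕ} {N : Submodule R (E q R)}
    (h : ∀ τ : Finset (Fin q), τ.card = i → (e τ : E q R) ∈ N) : H q R i ≤ N := supp_le h

lemma W_H {a b : ℕ} {x y : E q R} (hx : x ∈ H q R a) (hy : y ∈ H q R b) :
    W q R x y ∈ H q R (a + b) := by
  refine H_le (N := (H q R (a + b)).comap ((W q R).flip y)) ?_ hx
  intro σ hσ
  change W q R (e σ) y ∈ H q R (a + b)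
  refine H_le (N := (H q R (a + b)).comap (W q R (e σ))) ?_ hy
  intro τ hτ
  rw [Submodule.mem_comap, W_e]
  by_cases h : Disjoint σ τ
  · refine Submodule.smul_mem _ _ ?_
    rw [← hσ, ← hτ, ← Finset.card_union_of_disjoint h]
    exact e_H _
  · rw [fsign_zero h]; simp

lemma d_H {i : ℕ} {x : E q R} (hx : x ∈ H q R (i + 1)) : d q R x ∈ H q R i := by
  refine H_le (N := (H q R i).comap (d q R)) ?_ hx
  intro τ hτ
  rw [Submodule.mem_comap, d_e]
  refine Submodule.sum_mem _ fun j hj => Submodule.smul_mem _ _ ?_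
  have : (τ \ {j}).card = i := by
    rw [Finset.sdiff_singleton_eq_erase, Finset.card_erase_of_mem hj, hτ]; rfl
  rw [← this]; exact e_H _

lemma d_H0 {x : E q R} (hx : x ∈ H q R 0) : d q R x = 0 := by
  refine H_le (N := LinearMap.ker (d q R)) ?_ hx
  intro τ hτ
  rw [Finset.card_eq_zero] at hτ
  rw [hτ, LinearMap.mem_ker, d_empty]

lemma hh_H {i : ℕ} {x : E q R} (hx : x ∈ H q R i) : hh R S p x ∈ H q R (i + 1) := by
  rw [hh_apply, add_comm]
  refine W_H (e_H {p}) ?_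
  refine H_le (N := (H q R i).comap (P R S)) ?_ hx
  intro τ hτ
  rw [Submodule.mem_comap]
  by_cases h : S ⊆ τ
  · rw [P_e_pos h, ← hτ]; exact e_H _
  · rw [P_e_neg h]; exact Submodule.zero_mem _

lemma pr_H {i : ℕ} {x : E q R} (hx : x ∈ H q R i) : pr R S p x ∈ H q R i := by
  rw [pr_apply]
  refine Submodule.sub_mem _ (Submodule.sub_mem _ hx (d_H (hh_H S hx))) ?_
  cases i with
  | zero => rw [d_H0 hx, map_zero]; exact Submodule.zero_mem _
  | succ i => exact hh_H S (d_H hx)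

open Classical in
lemma P_coe (x : E q R) (τ : Finset (Fin q)) : P R S x τ = if S ⊆ τ then x τ else 0 := by
  induction x using Finsupp.induction_linear with
  | zero => simp
  | add f g hf hg => rw [map_add, Finsupp.add_apply, hf, hg]; split_ifs <;> simp
  | single A a =>
    have hs : Finsupp.single A a = a • (e A : E q R) := by simp
    rw [hs, map_smul]
    by_cases hA : S ⊆ A
    · rw [P_e_pos hA]
      by_cases h : A = τ
      · subst h; simp [hA]
      · simp [h]
    · rw [P_e_neg hA]
      by_cases h : A = τ
      · subst h; simp [hA]
      · simp [h]

lemma P_zero_iff (x : E q R) : P R S x = 0 ↔ ∀ τ, S ⊆ τ → x τ = 0 := by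
  classical
  constructor
  · intro h τ hτ
    have := P_coe S x τ
    rw [h, if_pos hτ] at this
    exact this.symm
  · intro h
    ext1 τ
    rw [P_coe]; split_ifs with h1
    · rw [h τ h1]; rfl
    · rfl

lemma W_comm {a b : ℕ} {x y : E q R} (hx : x ∈ H q R a) (hy : y ∈ H q R b) :
    W q R x y = ((-1 : ℤ) ^ (a * b)) • W q R y x := by
  have : x ∈ LinearMap.eqLocus ((W q R).flip y) (((-1 : ℤ) ^ (a * b)) • W q R y) := by
    refine H_le ?_ hx
    intro σ hσ
    rw [LinearMap.mem_eqLocus]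
    change W q R (e σ) y = ((-1 : ℤ) ^ (a * b)) • W q R y (e σ)
    have : y ∈ LinearMap.eqLocus (W q R (e σ)) (((-1 : ℤ) ^ (a * b)) • (W q R).flip (e σ)) := by
      refine H_le ?_ hy
      intro τ hτ
      rw [LinearMap.mem_eqLocus]
      change W q R (e σ) (e τ) = ((-1 : ℤ) ^ (a * b)) • W q R (e τ) (e σ)
      rw [W_e, W_e, fsign_comm, hσ, hτ, Finset.union_comm, Int.cast_mul, mul_smul,
        Int.cast_smul_eq_zsmul]
    exact this
  exact this

lemma W_sq {a : ℕ} (ha : Odd a) {x : E q R} (hx : x ∈ H q R a) : W q R x x = 0 := by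
  have h := hx
  rw [H, Finsupp.supported_eq_span_single] at h
  clear hx
  have key : x ∈ H q R a ∧ W q R x x = 0 := by
    induction h using Submodule.span_induction with
    | mem x hx =>
      obtain ⟨τ, hτ, rfl⟩ := hx
      refine ⟨by have := e_H (R := R) τ; rwa [show τ.card = a from hτ] at this, ?_⟩
      change W q R (e τ) (e τ) = 0
      rw [W_e, fsign_zero]
      · simp
      · intro h
        rw [disjoint_self] at h
        rw [h] at hτ
        have : a = 0 := by simpa using hτ.symm
        subst this; simp at ha
    | zero => exact ⟨Submodule.zero_mem _, by simp⟩
    | add x y _ _ hx hy =>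
      refine ⟨Submodule.add_mem _ hx.1 hy.1, ?_⟩
      have h1 := W_comm hx.1 hy.1
      rw [(ha.mul ha).neg_one_pow] at h1
      simp [hx.2, hy.2, h1]
    | smul r x _ hx =>
      exact ⟨Submodule.smul_mem _ _ hx.1, by simp [hx.2]⟩
  exact key.2

end ext
end Piv

namespace Piv

section transfer
variable {k : Type*} [Field k] {n q : ℕ} (D : Fin q → (Fin n →₀ ℕ))

local notation "QQ" => MvPolynomial (Fin n) k

variable (k) in
noncomputable def mon (u : Fin n →₀ ℕ) : MvPolynomial (Fin n) k := monomial u 1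

lemma mon_mul (u v : Fin n →₀ ℕ) : mon k u * mon k v = mon k (u + v) := by
  simp [mon, monomial_mul]

lemma mon_ne (u : Fin n →₀ ℕ) : mon k u ≠ 0 := by simp [mon]

variable (k) in
noncomputable def phi : TotMod k n q →ₗ[QQ] E q QQ :=
  Finsupp.linearCombination _ fun τ => mon k (τ.sup D) • e τ

lemma phi_e (τ : Finset (Fin q)) : phi k D (e τ) = mon k (τ.sup D) • e τ := by simp [phi]

lemma phi_coe (x : TotMod k n q) (τ : Finset (Fin q)) :
    phi k D x τ = mon k (τ.sup D) * x τ := by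
  induction x using Finsupp.induction_linear with
  | zero => simp
  | add f g hf hg => rw [map_add, Finsupp.add_apply, hf, hg]; simp [mul_add]
  | single A a =>
    have hs : Finsupp.single A a = a • (e A : E q QQ) := by simp
    rw [hs, map_smul, phi_e]
    by_cases h : A = τ
    · subst h; simp [mul_comm]
    · simp [h]

lemma phi_zero_iff (x : TotMod k n q) (τ : Finset (Fin q)) : phi k D x τ = 0 ↔ x τ = 0 := by
  rw [phi_coe]; simp [mon_ne]

lemma phi_inj : Function.Injective (phi k D) := by
  rw [injective_iff_map_eq_zero]
  intro x hx
  ext1 τ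
  have := (phi_zero_iff D x τ).1 (by rw [hx]; rfl)
  rw [this]; rfl

lemma mem_supp_iff (x : TotMod k n q) (Ω : Set (Finset (Fin q))) :
    x ∈ Finsupp.supported QQ QQ Ω ↔ ∀ τ, τ ∉ Ω → x τ = 0 := by
  rw [Finsupp.mem_supported']

lemma mem_subcx_iff (S : Finset (Fin q)) (x : TotMod k n q) :
    x ∈ subcx k n q (pivotΩ S) ↔ P QQ S (phi k D x) = 0 := by
  rw [subcx, mem_supp_iff, P_zero_iff]
  simp only [phi_zero_iff, pivotΩ, Set.mem_setOf_eq, not_not]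

lemma mem_piece_iff (S : Finset (Fin q)) (x : TotMod k n q) (i : ℕ) :
    x ∈ piece k n q (pivotΩ S) i ↔ P QQ S (phi k D x) = 0 ∧ phi k D x ∈ H q QQ i := by
  rw [piece, mem_supp_iff, P_zero_iff, H, mem_supp_iff]
  simp only [phi_zero_iff, pivotΩ, Set.mem_setOf_eq]
  constructor
  · intro h
    exact ⟨fun τ hτ => h τ (fun h' => h'.1 hτ), fun τ hτ => h τ (fun h' => hτ h'.2)⟩
  · rintro ⟨h1, h2⟩ τ hτ
    by_cases hs : S ⊆ τ
    · exact h1 τ hs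
    · exact h2 τ (fun h => hτ ⟨hs, h⟩)

lemma taylorD_e (τ : Finset (Fin q)) : taylorD k n q D (e τ) =
    ∑ j ∈ τ, ((fsign {j} (τ \ {j}) : QQ) * mon k (τ.sup D - (τ \ {j}).sup D)) • e (τ \ {j}) := by
  simp [taylorD, mon]

lemma phi_taylorD (x : TotMod k n q) : phi k D (taylorD k n q D x) = d q QQ (phi k D x) := by
  have : phi k D ∘ₗ taylorD k n q D = d q QQ ∘ₗ phi k D := hom_ext fun τ => by
    simp only [LinearMap.comp_apply]
    rw [taylorD_e, phi_e, map_smul, d_e, map_sum, Finset.smul_sum]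
    refine Finset.sum_congr rfl fun j hj => ?_
    rw [map_smul, phi_e, smul_smul, smul_smul, mul_assoc, mon_mul,
      tsub_add_cancel_of_le (Finset.sup_mono Finset.sdiff_subset), mul_comm]
  exact LinearMap.congr_fun this x

variable (k) in
noncomputable def TW : TotMod k n q →ₗ[QQ] TotMod k n q →ₗ[QQ] TotMod k n q :=
  Finsupp.linearCombination QQ fun σ => Finsupp.linearCombination QQ fun τ =>
    ((fsign σ τ : QQ) * mon k (σ.sup D + τ.sup D - (σ ∪ τ).sup D)) • e (σ ∪ τ)

lemma TW_e (σ τ : Finset (Fin q)) : TW k D (e σ) (e τ) =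
    ((fsign σ τ : QQ) * mon k (σ.sup D + τ.sup D - (σ ∪ τ).sup D)) • e (σ ∪ τ) := by
  simp [TW]

lemma phi_TW (x y : TotMod k n q) :
    phi k D (TW k D x y) = W q QQ (phi k D x) (phi k D y) := by
  have : (TW k D).compr₂ (phi k D) = (W q QQ).compl₁₂ (phi k D) (phi k D) :=
    hom_ext fun σ => hom_ext fun τ => by
      rw [LinearMap.compr₂_apply, LinearMap.compl₁₂_apply, TW_e, phi_e, phi_e, map_smul, phi_e,
        map_smul, map_smul, LinearMap.smul_apply, W_e, smul_smul, smul_smul, smul_smul,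
        mul_assoc, mon_mul, mon_mul, tsub_add_cancel_of_le, mul_comm, add_comm]
      rw [Finset.sup_union]
      exact sup_le le_self_add le_add_self
  exact LinearMap.congr_fun (LinearMap.congr_fun this x) y

lemma phi_hh (S : Finset (Fin q)) (p : Fin q) (hD : D p ≤ S.sup D) (x : TotMod k n q) :
    phi k D (hh QQ S p x) = hh QQ S p (phi k D x) := by
  have : phi k D ∘ₗ hh QQ S p = hh QQ S p ∘ₗ phi k D := hom_ext fun τ => by
    simp only [LinearMap.comp_apply]
    rw [phi_e, map_smul]
    by_cases h : S ⊆ τ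
    · have h1 : ({p} ∪ τ).sup D = τ.sup D := by
        rw [Finset.sup_union, Finset.sup_singleton, sup_eq_right]
        exact hD.trans (Finset.sup_mono h)
      rw [hh_e S τ h, map_smul, phi_e, h1, smul_comm]
    · rw [hh_apply, P_e_neg h]; simp
  exact LinearMap.congr_fun this x

variable (k) in
noncomputable def mulT (S : Finset (Fin q)) (p : Fin q) :
    TotMod k n q →ₗ[QQ] TotMod k n q →ₗ[QQ] TotMod k n q :=
  (TW k D).compr₂ (LinearMap.id - taylorD k n q D ∘ₗ hh QQ S p - hh QQ S p ∘ₗ taylorD k n q D)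

lemma phi_mulT (S : Finset (Fin q)) (p : Fin q) (hD : D p ≤ S.sup D) (x y : TotMod k n q) :
    phi k D (mulT k D S p x y) = pr QQ S p (W q QQ (phi k D x) (phi k D y)) := by
  rw [mulT, LinearMap.compr₂_apply]
  simp only [LinearMap.sub_apply, LinearMap.comp_apply, LinearMap.id_apply, map_sub,
    phi_taylorD, phi_hh D S p hD, phi_TW, pr_apply]

lemma exists_p (S : Finset (Fin q)) (hS : 2 ≤ S.card)
    (hres : IsResolutionOf k n q D (pivotΩ S)) : ∃ p, p ∉ S ∧ D p ≤ S.sup D := by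
  by_contra hcon
  push Not at hcon
  obtain ⟨i, hi⟩ : ∃ i, S.card = i + 2 := ⟨S.card - 2, by omega⟩
  have hS1 : (e S : E q QQ) ∈ H q QQ (i + 2) := by rw [← hi]; exact e_H S
  obtain ⟨y, hy, hyx⟩ := hres.1 i (taylorD k n q D (e S)) (by
    rw [mem_piece_iff D]
    rw [phi_taylorD, phi_e, map_smul]
    refine ⟨?_, Submodule.smul_mem _ _ (d_H hS1)⟩
    rw [map_smul, d_e, map_sum, Finset.sum_eq_zero, smul_zero]
    intro j hj
    rw [map_smul, P_e_neg, smul_zero]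
    intro h
    have := h hj
    simp at this) (phi_inj D (by rw [phi_taylorD, phi_taylorD, d_d, map_zero]))
  rw [piece, mem_supp_iff] at hy
  obtain ⟨j, hj⟩ : S.Nonempty := Finset.card_pos.1 (by omega)
  set u := S.sup D - (S \ {j}).sup D with hu
  have h1 : ∀ x : TotMod k n q, (∀ τ, τ ∉ {τ | τ ∈ pivotΩ S ∧ τ.card = i + 2} → x τ = 0) →
      coeff u (taylorD k n q D x (S \ {j})) = 0 := by
    intro x hx
    have hx' : x = x.sum Finsupp.single := x.sum_single.symm
    rw [hx', Finsupp.sum, map_sum, Finsupp.finset_sum_apply, coeff_sum]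
    refine Finset.sum_eq_zero fun τ hτ => ?_
    have hτ2 : τ ∈ pivotΩ S ∧ τ.card = i + 2 := by
      by_contra hc
      exact (Finsupp.mem_support_iff.1 hτ) (hx τ hc)
    have hs : Finsupp.single τ (x τ) = x τ • (e τ : E q QQ) := by simp
    rw [hs, map_smul, taylorD_e, Finset.smul_sum, Finsupp.finset_sum_apply, coeff_sum]
    refine Finset.sum_eq_zero fun a ha => ?_
    by_cases hE : τ \ {a} = S \ {j}
    · have haS : a ∉ S := by
        intro haS
        apply hτ2.1
        have : a = j := by
          by_contra hne
          have : a ∈ S \ {j} := by simp [haS, hne]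
          rw [← hE] at this; simp at this
        subst this
        intro b hb
        by_cases hba : b = a
        · rw [hba]; exact ha
        · have : b ∈ S \ {a} := by simp [hb, hba]
          rw [← hE] at this
          exact (Finset.mem_sdiff.1 this).1
      have hle : ¬ (τ.sup D - (τ \ {a}).sup D ≤ u) := by
        intro hle
        rw [hE, hu] at hle
        have h5 : (S \ {j}).sup D ≤ τ.sup D := by
          rw [← hE]; exact Finset.sup_mono Finset.sdiff_subset
        have h6 := tsub_le_iff_right.1 hle
        rw [tsub_add_cancel_of_le (Finset.sup_mono Finset.sdiff_subset)] at h6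
        exact hcon a haS ((Finset.le_sup ha).trans h6)
      simp only [Finsupp.smul_apply, smul_eq_mul, hE, Finsupp.single_eq_same, mul_one]
      rw [← mul_assoc, mon, coeff_mul_monomial', if_neg]
      rw [← hE]; exact hle
    · simp [Ne.symm hE, hE]
  have h2 := h1 y hy
  rw [hyx, taylorD_e, Finsupp.finset_sum_apply, coeff_sum, Finset.sum_eq_single_of_mem j hj] at h2
  · simp only [Finsupp.smul_apply, smul_eq_mul, Finsupp.single_eq_same, mul_one] at h2
    rw [mon, coeff_mul_monomial', if_pos le_rfl, mul_one, tsub_self] at h2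
    have h3 := congrArg (fun z : ℤ => (z : k)) (fsign_sq (A := {j}) (B := S \ {j})
      Finset.disjoint_sdiff)
    have h4 : coeff 0 ((fsign {j} (S \ {j}) : ℤ) : QQ) = ((fsign {j} (S \ {j}) : ℤ) : k) := by
      rw [← map_intCast (C : k →+* QQ), coeff_zero_C]
    rw [h4] at h2
    simp only [Int.cast_mul, h2] at h3
    simp at h3
  · intro b hb hbj
    have : ¬ (S \ {b} = S \ {j}) := by
      intro h
      have : b ∈ S \ {j} := by simp [hb, hbj]
      rw [← h] at this; simp at this
    simp [this, Ne.symm this]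

end transfer
end Piv

/-- **Pivot resolutions are DG-algebras.**
If the pivot complex `T_S` is a resolution of `Q/I`, then it carries the
structure of a DG-algebra over `Q`: a bilinear multiplication `⋆` (given here as a
bilinear map on the ambient Taylor module preserving the pivot subcomplex and its
grading), with unit `ε_∅`, graded-commutative (including `x ⋆ x = 0` in odd
degrees), associative, and satisfying the Leibniz rule. -/
theorem pivot_resolution_is_DG_algebra {k : Type*} [Field k] {n q : ℕ}
    (D : Fin q → (Fin n →₀ ℕ))
    (hne : ∀ i : Fin q, D i ≠ 0)
    (hmin : ∀ i j : Fin q, i ≠ j → ¬ lcmMono k n q D {i} ∣ lcmMono k n q D {j})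
    (S : Finset (Fin q)) (hS : 2 ≤ S.card)
    (hres : IsResolutionOf k n q D (pivotΩ S)) :
    ∃ mul : TotMod k n q →ₗ[MvPolynomial (Fin n) k]
        TotMod k n q →ₗ[MvPolynomial (Fin n) k] TotMod k n q,
      -- the multiplication is graded: `(T_S)_a ⋆ (T_S)_b ⊆ (T_S)_{a+b}`
      (∀ a b : ℕ, ∀ x ∈ piece k n q (pivotΩ S) a, ∀ y ∈ piece k n q (pivotΩ S) b,
          mul x y ∈ piece k n q (pivotΩ S) (a + b)) ∧
      -- `ε_∅` is a unit
      (∀ x ∈ subcx k n q (pivotΩ S),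
          mul (Finsupp.single (∅ : Finset (Fin q)) 1) x = x ∧
          mul x (Finsupp.single (∅ : Finset (Fin q)) 1) = x) ∧
      -- graded-commutativity
      (∀ a b : ℕ, ∀ x ∈ piece k n q (pivotΩ S) a, ∀ y ∈ piece k n q (pivotΩ S) b,
          mul x y = ((-1 : ℤ) ^ (a * b)) • mul y x) ∧
      -- squares vanish in odd degree
      (∀ a : ℕ, Odd a → ∀ x ∈ piece k n q (pivotΩ S) a, mul x x = 0) ∧
      -- associativity
      (∀ x ∈ subcx k n q (pivotΩ S), ∀ y ∈ subcx k n q (pivotΩ S),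
          ∀ z ∈ subcx k n q (pivotΩ S), mul (mul x y) z = mul x (mul y z)) ∧
      -- Leibniz rule
      (∀ a : ℕ, ∀ x ∈ piece k n q (pivotΩ S) a, ∀ y ∈ subcx k n q (pivotΩ S),
          taylorD k n q D (mul x y) =
            mul (taylorD k n q D x) y + ((-1 : ℤ) ^ a) • mul x (taylorD k n q D y)) := by

  obtain ⟨p, hp, hD⟩ := Piv.exists_p D S hS hres
  have hphi := Piv.phi_mulT (k := k) D S p hD
  have hpm := Piv.mem_piece_iff (k := k) D S
  have hsm := Piv.mem_subcx_iff (k := k) D S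
  have h0 : Piv.phi k D (Finsupp.single (∅ : Finset (Fin q)) 1) = Piv.e ∅ := by
    rw [Piv.phi_e, Finset.sup_empty, bot_eq_zero]; simp [Piv.mon]
  refine ⟨Piv.mulT k D S p, ?_, ?_, ?_, ?_, ?_, ?_⟩
  · intro a b x hx y hy
    rw [hpm] at hx hy ⊢
    rw [hphi]
    exact ⟨Piv.P_pr S hp _, Piv.pr_H S (Piv.W_H hx.2 hy.2)⟩
  · intro x hx
    rw [hsm] at hx
    constructor
    · apply Piv.phi_inj D
      rw [hphi, h0, Piv.W_empty_left, Piv.pr_of S _ hx]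
    · apply Piv.phi_inj D
      rw [hphi, h0, Piv.W_empty_right, Piv.pr_of S _ hx]
  · intro a b x hx y hy
    rw [hpm] at hx hy
    apply Piv.phi_inj D
    rw [map_zsmul, hphi, hphi, Piv.W_comm hx.2 hy.2, map_zsmul]
  · intro a ha x hx
    rw [hpm] at hx
    apply Piv.phi_inj D
    rw [hphi, Piv.W_sq ha hx.2, map_zero, map_zero]
  · intro x _ y _ z _
    apply Piv.phi_inj D
    rw [hphi, hphi, hphi, hphi, Piv.pr_W_pr_left S hp, Piv.pr_W_pr_right S hp, Piv.W_assoc]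
  · intro a x hx y _
    rw [hpm] at hx
    apply Piv.phi_inj D
    have hs : Piv.s q _ (Piv.phi k D x) = ((-1 : ℤ) ^ a) • Piv.phi k D x := by
      have : Piv.phi k D x ∈ LinearMap.eqLocus (Piv.s q (MvPolynomial (Fin n) k))
          (((-1 : ℤ) ^ a) • LinearMap.id) := by
        refine Piv.H_le ?_ hx.2
        intro τ hτ
        rw [LinearMap.mem_eqLocus, Piv.s_e, hτ]
        change _ = ((-1 : ℤ) ^ a) • Piv.e τ
        rw [← Int.cast_smul_eq_zsmul (MvPolynomial (Fin n) k)]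
        simp
      exact this
    rw [Piv.phi_taylorD, hphi, Piv.d_pr, Piv.leib, hs, map_add (Piv.phi k D), map_zsmul (Piv.phi k D),
      hphi, hphi, Piv.phi_taylorD, Piv.phi_taylorD, map_add, map_zsmul (Piv.W q (MvPolynomial (Fin n) k)),
      LinearMap.smul_apply, map_zsmul]
end

section
/- Suppose s := scarf(I) < ∞ and let F be a minimal free resolution of Q/I over Q. Then for every i, rank F_i ≤ binom(q,i) − binom(q−s, i−s); equivalently, β_i^Q(Q/I) ≤ binom(q,i) − binom(q−s, i−s) for all i. -/
open MvPolynomial Finset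

/-- A minimal free resolution of a module `M` over a ring `R` with distinguished
(irrelevant maximal) ideal `mR`: free modules `F_i` of rank `rk i`, differentials
`d i : F_{i+1} → F_i`, an augmentation `F_0 ↠ M` with `ker(aug) = im(d 0)`,
exactness everywhere else, and minimality `∂(F_{i+1}) ⊆ mR·F_i`. -/
structure MinimalFreeResolution (R : Type*) [CommRing R] (mR : Ideal R)
    (M : Type*) [AddCommGroup M] [Module R M] where
  rk : ℕ → ℕ
  d : ∀ i : ℕ, (Fin (rk (i + 1)) →₀ R) →ₗ[R] (Fin (rk i) →₀ R)
  aug : (Fin (rk 0) →₀ R) →ₗ[R] M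
  aug_surjective : Function.Surjective aug
  exact_zero : LinearMap.range (d 0) = LinearMap.ker aug
  exact_succ : ∀ i : ℕ, LinearMap.range (d (i + 1)) = LinearMap.ker (d i)
  minimal : ∀ i : ℕ,
    LinearMap.range (d i) ≤ mR • (⊤ : Submodule R (Fin (rk i) →₀ R))

namespace ScarfAux

section Comparison

variable {R : Type*} [CommRing R]

theorem lift_range {P M N : Type*} [AddCommGroup P] [Module R P] [Module.Projective R P]
    [AddCommGroup M] [Module R M] [AddCommGroup N] [Module R N]
    (d : M →ₗ[R] N) (φ : P →ₗ[R] N) (h : ∀ x, φ x ∈ LinearMap.range d) :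
    ∃ ψ : P →ₗ[R] M, ∀ x, d (ψ x) = φ x := by
  obtain ⟨ψ, hψ⟩ := Module.projective_lifting_property d.rangeRestrict
    (φ.codRestrict (LinearMap.range d) h) d.surjective_rangeRestrict
  refine ⟨ψ, fun x => ?_⟩
  have := congrArg Subtype.val (LinearMap.congr_fun hψ x)
  simpa using this

theorem comparison {mR : Ideal R} {M : Type*} [AddCommGroup M] [Module R M]
    (F : MinimalFreeResolution R mR M)
    (G : ℕ → Type*) [∀ i, AddCommGroup (G i)] [∀ i, Module R (G i)]
    [∀ i, Module.Projective R (G i)]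
    (d : ∀ i, G (i + 1) →ₗ[R] G i) (aug : G 0 →ₗ[R] M)
    (haug : Function.Surjective aug)
    (h0 : LinearMap.range (d 0) = LinearMap.ker aug)
    (hs : ∀ i, LinearMap.range (d (i + 1)) = LinearMap.ker (d i)) (i : ℕ) :
    ∃ (f : (Fin (F.rk i) →₀ R) →ₗ[R] G i) (g : G i →ₗ[R] (Fin (F.rk i) →₀ R))
      (h : (Fin (F.rk i) →₀ R) →ₗ[R] (Fin (F.rk (i + 1)) →₀ R)),
      (∀ x, f (F.d i x) ∈ LinearMap.range (d i)) ∧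
      (∀ x, g (d i x) ∈ LinearMap.range (F.d i)) ∧
      (∀ x, g (f (F.d i x)) - F.d i x = F.d i (h (F.d i x))) ∧
      (∀ x, g (f x) - x ∈ mR • (⊤ : Submodule R (Fin (F.rk i) →₀ R))) := by
  induction i with
  | zero =>
    obtain ⟨f, hf⟩ := lift_range aug F.aug (fun x => haug _)
    obtain ⟨g, hg⟩ := lift_range F.aug aug (fun x => F.aug_surjective _)
    obtain ⟨h, hh⟩ := lift_range (F.d 0) (g ∘ₗ f - LinearMap.id) (fun x => by
      rw [F.exact_zero]
      simp [hf, hg])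
    simp only [LinearMap.sub_apply, LinearMap.comp_apply, LinearMap.id_apply] at hh
    refine ⟨f, g, h, fun x => ?_, fun x => ?_, fun x => (hh _).symm, fun x => ?_⟩
    · rw [h0, LinearMap.mem_ker, hf, ← LinearMap.mem_ker, ← F.exact_zero]
      exact ⟨x, rfl⟩
    · rw [F.exact_zero, LinearMap.mem_ker, hg, ← LinearMap.mem_ker, ← h0]
      exact ⟨x, rfl⟩
    · rw [← hh]
      exact F.minimal 0 ⟨_, rfl⟩
  | succ i ih =>
    obtain ⟨f, g, h, h1, h2, h3, h4⟩ := ih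
    obtain ⟨f', hf⟩ := lift_range (d i) (f ∘ₗ F.d i) h1
    obtain ⟨g', hg⟩ := lift_range (F.d i) (g ∘ₗ d i) h2
    simp only [LinearMap.comp_apply] at hf hg
    have dd : ∀ x, d i (d (i + 1) x) = 0 := fun x => by
      rw [← LinearMap.mem_ker, ← hs]; exact ⟨x, rfl⟩
    have DD : ∀ x, F.d i (F.d (i + 1) x) = 0 := fun x => by
      rw [← LinearMap.mem_ker, ← F.exact_succ]; exact ⟨x, rfl⟩
    obtain ⟨h', hh⟩ := lift_range (F.d (i + 1)) (g' ∘ₗ f' - LinearMap.id - h ∘ₗ F.d i)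
      (fun x => by
        rw [F.exact_succ]
        simp [hf, hg, h3])
    simp only [LinearMap.sub_apply, LinearMap.comp_apply, LinearMap.id_apply] at hh
    refine ⟨f', g', h', fun x => ?_, fun x => ?_, fun x => ?_, fun x => ?_⟩
    · rw [hs, LinearMap.mem_ker, hf, DD, map_zero]
    · rw [F.exact_succ, LinearMap.mem_ker, hg, dd, map_zero]
    · rw [hh, DD, map_zero, sub_zero]
    · have e : g' (f' x) - x = F.d (i + 1) (h' x) + h (F.d i x) := by rw [hh]; abel
      rw [e]
      refine add_mem (F.minimal _ ⟨_, rfl⟩) ?_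
      have := Submodule.mem_map_of_mem (f := h) (F.minimal i ⟨x, rfl⟩)
      rw [Submodule.map_smul''] at this
      exact Submodule.smul_mono le_rfl le_top this

theorem mem_smul_top {K : Type*} [Field K] (ε : R →+* K) {mR : Ideal R}
    (hε : ∀ a ∈ mR, ε a = 0) {r : ℕ} {x : Fin r →₀ R}
    (hx : x ∈ mR • (⊤ : Submodule R (Fin r →₀ R))) (j : Fin r) : ε (x j) = 0 := by
  induction hx using Submodule.smul_induction_on' with
  | smul a ha y _ => simp [hε a ha]
  | add x _ y _ h1 h2 => simp [h1, h2]

theorem rank_le {K : Type*} [Field K] (ε : R →+* K) {mR : Ideal R}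
    (hε : ∀ a ∈ mR, ε a = 0) {r : ℕ} {ι : Type*} [Fintype ι]
    (f : (Fin r →₀ R) →ₗ[R] (ι → R)) (g : (ι → R) →ₗ[R] (Fin r →₀ R))
    (h : ∀ x, g (f x) - x ∈ mR • (⊤ : Submodule R (Fin r →₀ R))) : r ≤ Fintype.card ι := by
  classical
  let A : Matrix ι (Fin r) K := Matrix.of fun t j => ε (f (Finsupp.single j 1) t)
  let B : Matrix (Fin r) ι K := Matrix.of fun j t => ε (g (Pi.single t 1) j)
  have hBA : B * A = 1 := by
    ext i j
    have h1 := mem_smul_top ε hε (h (Finsupp.single j 1)) i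
    rw [Finsupp.sub_apply, map_sub, sub_eq_zero] at h1
    have h2 : f (Finsupp.single j 1) =
        ∑ t, f (Finsupp.single j 1) t • (Pi.single t (1 : R) : ι → R) := by
      exact pi_eq_sum_univ' _
    rw [h2, map_sum, Finsupp.finsetSum_apply, map_sum] at h1
    simp only [map_smul, Finsupp.smul_apply, smul_eq_mul, map_mul] at h1
    rw [Matrix.mul_apply]
    simp only [A, B, Matrix.of_apply]
    rw [Finset.sum_congr rfl (fun t _ => mul_comm _ _), h1, Finsupp.single_apply,
      Matrix.one_apply]
    simp only [eq_comm]
    split_ifs <;> simp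
  have h3 := Matrix.rank_mul_le_left B A
  rw [hBA, Matrix.rank_one] at h3
  simpa using h3.trans (Matrix.rank_le_card_width B)

end Comparison

section Simplex

set_option linter.unusedSectionVars false

variable {α : Type*} [Fintype α] [LinearOrder α]

def sg (j : α) (σ : Finset α) : ℤ := (-1) ^ (σ.filter (· < j)).card

theorem sg_sq (j : α) (σ : Finset α) : sg j σ * sg j σ = 1 := by
  simp [sg, ← mul_pow]

theorem sg_insert_self (j : α) (σ : Finset α) : sg j (insert j σ) = sg j σ := by
  simp [sg, Finset.filter_insert]

theorem sg_erase_self (j : α) (σ : Finset α) : sg j (σ.erase j) = sg j σ := by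
  by_cases h : j ∈ σ
  · rw [← sg_insert_self, Finset.insert_erase h]
  · rw [Finset.erase_eq_of_notMem h]

theorem sg_insert {i j : α} (σ : Finset α) (h : i ∉ σ) :
    sg j (insert i σ) = (if i < j then -1 else 1) * sg j σ := by
  unfold sg
  rw [Finset.filter_insert]
  split_ifs with hij
  · rw [Finset.card_insert_of_notMem (by simp [h]), pow_succ]; ring
  · simp

theorem sg_cancel {v j : α} {σ : Finset α} (hv : v ∈ σ) (hj : j ∉ σ) :
    sg j σ * sg v (insert j σ) + sg v σ * sg j (σ.erase v) = 0 := by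
  have hne : v ≠ j := fun h => hj (h ▸ hv)
  have e : sg j σ = (if v < j then -1 else 1) * sg j (σ.erase v) := by
    rw [← sg_insert _ (Finset.notMem_erase v σ), Finset.insert_erase hv]
  rw [sg_insert _ hj, e]
  rcases lt_or_gt_of_ne hne with h | h
  · simp [h, h.not_gt]; ring
  · simp [h, h.not_gt]; ring

variable (R : Type*) [CommRing R] {M : Type*} [AddCommGroup M] [Module R M]

def bd : (Finset α → M) →ₗ[R] (Finset α → M) where
  toFun y σ := ∑ j ∈ σᶜ, sg j σ • y (insert j σ)
  map_add' x y := by ext σ; simp [Finset.sum_add_distrib]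
  map_smul' r y := by ext σ; simp [Finset.smul_sum, smul_comm r]

theorem bd_apply (y : Finset α → M) (σ : Finset α) :
    bd R y σ = ∑ j ∈ σᶜ, sg j σ • y (insert j σ) := rfl

def cone (v : α) (y : Finset α → M) : Finset α → M :=
  fun τ => if v ∈ τ then sg v τ • y (τ.erase v) else 0

theorem homotopy (v : α) (y : Finset α → M) : bd R (cone v y) + cone v (bd R y) = y := by
  ext σ
  rw [Pi.add_apply, bd_apply]
  by_cases hv : v ∈ σ
  · have hc : (σ.erase v)ᶜ = insert v σᶜ := by
      ext t; simp [Finset.mem_erase]; try tauto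
    simp only [cone, hv, if_true, Finset.mem_insert, or_true, bd_apply, hc]
    rw [Finset.sum_insert (by simp [hv]), Finset.insert_erase hv, smul_add, smul_smul,
      sg_erase_self, sg_sq, one_smul, Finset.smul_sum, add_left_comm, ← Finset.sum_add_distrib,
      Finset.sum_eq_zero, add_zero]
    intro j hj
    have hj : j ∉ σ := by simpa using hj
    have hne : j ≠ v := fun h => hj (h ▸ hv)
    rw [Finset.erase_insert_of_ne hne, smul_smul, smul_smul, ← add_smul, sg_cancel hv hj,
      zero_smul]
  · simp only [cone, hv, if_false, add_zero, Finset.mem_insert, or_false]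
    rw [Finset.sum_eq_single v]
    · simp [hv, sg_insert_self, smul_smul, sg_sq]
    · intro j _ hj
      simp [hj.symm]
    · simp [hv]

theorem bd_bd (y : Finset α → M) : bd R (bd R y) = 0 := by
  suffices H : ∀ (N : ℕ) (σ : Finset α) (y : Finset α → M), σᶜ.card = N →
      bd R (bd R y) σ = 0 by
    ext σ; exact H _ σ y rfl
  intro N
  induction N with
  | zero =>
    intro σ y h
    rw [bd_apply, Finset.card_eq_zero.1 h, Finset.sum_empty]
  | succ N ih =>
    intro σ y h
    obtain ⟨v, hv⟩ : σᶜ.Nonempty := by rw [← Finset.card_pos]; omega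
    have hv' : v ∉ σ := by simpa using hv
    have h1 := ih (insert v σ) (cone v y) (by
      rw [Finset.compl_insert, Finset.card_erase_of_mem hv]; omega)
    have h2 : bd R (cone v y) = y - cone v (bd R y) := eq_sub_of_add_eq (homotopy R v y)
    have h3 := homotopy R v (bd R y)
    have h4 : bd R (bd R (cone v y)) = cone v (bd R (bd R y)) := by
      rw [h2, map_sub, sub_eq_iff_eq_add, add_comm]; exact h3.symm
    rw [h4] at h1
    simp only [cone, Finset.mem_insert_self, if_true, Finset.erase_insert hv'] at h1
    have h5 := congrArg (fun z => sg v (insert v σ) • z) h1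
    simpa [smul_smul, sg_sq] using h5

end Simplex

end ScarfAux

namespace ScarfAux

noncomputable section Pivot

variable {k : Type*} [Field k] {n q : ℕ}

/-- Good index sets in degree `i`. -/
def good (S : Finset (Fin q)) (i : ℕ) (τ : Finset (Fin q)) : Prop := τ.card = i ∧ ¬ S ⊆ τ

variable (k) in
def Gs (D : Fin q → (Fin n →₀ ℕ)) (S : Finset (Fin q)) (i : ℕ) :
    Submodule (MvPolynomial (Fin n) k) (Finset (Fin q) → MvPolynomial (Fin n) k) :=
  Submodule.pi Set.univ fun τ =>
    Ideal.span ((fun s => monomial s (1 : k)) '' {s | good S i τ ∧ s = τ.sup D})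

theorem mem_Gs {D : Fin q → (Fin n →₀ ℕ)} {S : Finset (Fin q)} {i : ℕ}
    {y : Finset (Fin q) → MvPolynomial (Fin n) k} :
    y ∈ Gs k D S i ↔ ∀ τ a, coeff a (y τ) ≠ 0 → good S i τ ∧ ∀ t ∈ τ, D t ≤ a := by
  simp only [Gs, Submodule.mem_pi, Set.mem_univ, true_implies, mem_ideal_span_monomial_image,
    mem_support_iff, Set.mem_ofPred_eq, ← Finset.sup_le_iff]
  refine forall_congr' fun τ => forall_congr' fun a => imp_congr_right fun _ => ?_
  constructor
  · rintro ⟨s, ⟨h, rfl⟩, h'⟩; exact ⟨h, h'⟩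
  · rintro ⟨h, h'⟩; exact ⟨_, ⟨h, rfl⟩, h'⟩

open Classical in
variable (k) in
def toT (D : Fin q → (Fin n →₀ ℕ)) (S : Finset (Fin q)) (i : ℕ) :
    ({τ // good S i τ} → MvPolynomial (Fin n) k) →ₗ[MvPolynomial (Fin n) k]
      (Finset (Fin q) → MvPolynomial (Fin n) k) where
  toFun w τ := if h : good S i τ then monomial (τ.sup D) (1 : k) * w ⟨τ, h⟩ else 0
  map_add' x y := by ext1 τ; by_cases h : good S i τ <;> simp [h, mul_add]
  map_smul' r y := by
    ext1 τ; by_cases h : good S i τ <;> simp [h, mul_left_comm]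

theorem toT_inj (D : Fin q → (Fin n →₀ ℕ)) (S : Finset (Fin q)) (i : ℕ) :
    Function.Injective (toT k D S i) := by
  intro x y hxy
  ext1 ⟨τ, hτ⟩
  have h := congrFun hxy τ
  simp only [toT, LinearMap.coe_mk, AddHom.coe_mk, hτ, dif_pos] at h
  exact mul_left_cancel₀ (by simp) h

theorem toT_range (D : Fin q → (Fin n →₀ ℕ)) (S : Finset (Fin q)) (i : ℕ) :
    LinearMap.range (toT k D S i) = Gs k D S i := by
  ext y
  simp only [Gs, Submodule.mem_pi, Set.mem_univ, true_implies]
  constructor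
  · rintro ⟨w, rfl⟩ τ
    by_cases h : good S i τ
    · simp only [toT, LinearMap.coe_mk, AddHom.coe_mk, h, dif_pos]
      exact Ideal.mul_mem_right _ _ (Ideal.subset_span ⟨_, ⟨trivial, rfl⟩, rfl⟩)
    · simp [toT, h]
  · intro hy
    have H : ∀ τ, good S i τ → ∃ w, y τ = monomial (τ.sup D) (1 : k) * w := by
      intro τ hτ
      have := hy τ
      simp only [hτ, true_and, Set.ofPred_eq_eq_singleton, Set.image_singleton,
        Ideal.mem_span_singleton] at this
      exact this
    choose w hw using H
    refine ⟨fun τ => w τ.1 τ.2, ?_⟩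
    ext1 τ
    by_cases h : good S i τ
    · simp only [toT, LinearMap.coe_mk, AddHom.coe_mk, h, dif_pos, ← hw τ h]
    · have := hy τ
      simp only [h, false_and, Set.ofPred_false, Set.image_empty, Ideal.span_empty,
        Ideal.mem_bot] at this
      simp [toT, h, this]

variable (k) in
def eqv (D : Fin q → (Fin n →₀ ℕ)) (S : Finset (Fin q)) (i : ℕ) :
    ({τ // good S i τ} → MvPolynomial (Fin n) k) ≃ₗ[MvPolynomial (Fin n) k] Gs k D S i :=
  (LinearEquiv.ofInjective _ (toT_inj D S i)).trans (LinearEquiv.ofEq _ _ (toT_range D S i))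

theorem bd_mem {D : Fin q → (Fin n →₀ ℕ)} {S : Finset (Fin q)} {i : ℕ}
    {y : Finset (Fin q) → MvPolynomial (Fin n) k} (hy : y ∈ Gs k D S (i + 1)) :
    bd (MvPolynomial (Fin n) k) y ∈ Gs k D S i := by
  rw [mem_Gs] at hy ⊢
  intro σ a ha
  rw [bd_apply, coeff_sum] at ha
  obtain ⟨j, hj, hja⟩ := Finset.exists_ne_zero_of_sum_ne_zero ha
  have hj : j ∉ σ := by simpa using hj
  have h1 : coeff a (y (insert j σ)) ≠ 0 := by
    intro h0
    apply hja
    have := congrArg (fun z => sg j σ • z) h0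
    rw [← lcoeff_apply (R := k)] 
    rw [map_zsmul, lcoeff_apply, h0, smul_zero]
  obtain ⟨⟨h2, h3⟩, h4⟩ := hy _ _ h1
  rw [Finset.card_insert_of_notMem hj] at h2
  exact ⟨⟨by omega, fun h => h3 (h.trans (Finset.subset_insert _ _))⟩,
    fun t ht => h4 t (Finset.mem_insert_of_mem ht)⟩

def comp (a : Fin n →₀ ℕ) (y : Finset (Fin q) → MvPolynomial (Fin n) k) :
    Finset (Fin q) → MvPolynomial (Fin n) k := fun τ => monomial a (coeff a (y τ))

theorem bd_comp (a : Fin n →₀ ℕ) (y : Finset (Fin q) → MvPolynomial (Fin n) k) :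
    bd (MvPolynomial (Fin n) k) (comp a y) = comp a (bd (MvPolynomial (Fin n) k) y) := by
  ext1 σ
  simp only [bd_apply, comp]
  rw [← lcoeff_apply (R := k), map_sum, map_sum]
  refine Finset.sum_congr rfl fun j _ => ?_
  rw [map_zsmul, map_zsmul, lcoeff_apply]

theorem fill {D : Fin q → (Fin n →₀ ℕ)} {S : Finset (Fin q)} {j : Fin q} (hj : j ∉ S)
    (hjD : D j ≤ S.sup D) {i : ℕ} {y : Finset (Fin q) → MvPolynomial (Fin n) k}
    (hy : y ∈ Gs k D S i) (hne : ∀ τ a, coeff a (y τ) ≠ 0 → ∃ t, D t ≤ a)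
    (hb : bd (MvPolynomial (Fin n) k) y = 0) :
    ∃ z ∈ Gs k D S (i + 1), bd (MvPolynomial (Fin n) k) z = y := by
  have hv : ∀ a : Fin n →₀ ℕ, ∃ v : Fin q, (∃ t, D t ≤ a) →
      D v ≤ a ∧ ((∀ s ∈ S, D s ≤ a) → v ∉ S) := by
    intro a
    by_cases h : ∀ s ∈ S, D s ≤ a
    · exact ⟨j, fun _ => ⟨hjD.trans (Finset.sup_le h), fun _ => hj⟩⟩
    · by_cases h' : ∃ t, D t ≤ a
      · obtain ⟨t, ht⟩ := h'
        exact ⟨t, fun _ => ⟨ht, fun h'' => absurd h'' h⟩⟩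
      · exact ⟨j, fun h'' => absurd h'' h'⟩
  choose v hv using hv
  rw [mem_Gs] at hy
  let A : Finset (Fin n →₀ ℕ) := Finset.univ.biUnion fun τ => (y τ).support
  refine ⟨∑ a ∈ A, cone (v a) (comp a y), Submodule.sum_mem _ fun a _ => ?_, ?_⟩
  · rw [mem_Gs]
    intro τ b hb
    simp only [cone, comp] at hb
    split_ifs at hb with hvt
    · rw [← map_zsmul, coeff_monomial] at hb
      split_ifs at hb with hab
      · subst hab
        have h1 : coeff a (y (τ.erase (v a))) ≠ 0 := by
          intro h0; rw [h0, smul_zero] at hb; exact hb rfl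
        obtain ⟨⟨h2, h3⟩, h4⟩ := hy _ _ h1
        obtain ⟨h5, h6⟩ := hv a (hne _ _ h1)
        have h7 : ∀ t ∈ τ, D t ≤ a := by
          intro t ht
          by_cases e : t = v a
          · rw [e]; exact h5
          · exact h4 t (Finset.mem_erase.2 ⟨e, ht⟩)
        refine ⟨⟨?_, fun hS => ?_⟩, h7⟩
        · rw [← h2, Finset.card_erase_add_one hvt]
        · refine h3 fun s hs => Finset.mem_erase.2 ⟨?_, hS hs⟩
          rintro rfl
          exact h6 (fun s hs => h7 s (hS hs)) hs
      · exact absurd rfl hb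
    · simp at hb
  · rw [map_sum]
    have h1 : ∀ a ∈ A, bd (MvPolynomial (Fin n) k) (cone (v a) (comp a y)) = comp a y := by
      intro a _
      have := homotopy (MvPolynomial (Fin n) k) (v a) (comp a y)
      rw [bd_comp, hb] at this
      have h0 : cone (v a) (comp a (0 : Finset (Fin q) → MvPolynomial (Fin n) k)) = 0 := by
        ext1 τ; simp [cone, comp]
      rwa [h0, add_zero] at this
    rw [Finset.sum_congr rfl h1]
    ext1 τ
    rw [Finset.sum_apply]
    simp only [comp]
    conv_rhs => rw [(y τ).as_sum]
    symm
    refine Finset.sum_subset (Finset.subset_biUnion_of_mem (fun τ => (y τ).support)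
      (Finset.mem_univ τ)) fun a _ ha => ?_
    rw [notMem_support_iff.1 ha, map_zero]

variable (k) in
def dG (D : Fin q → (Fin n →₀ ℕ)) (S : Finset (Fin q)) (i : ℕ) :
    Gs k D S (i + 1) →ₗ[MvPolynomial (Fin n) k] Gs k D S i :=
  (bd (MvPolynomial (Fin n) k)).restrict fun _ hy => bd_mem hy

variable (k) in
def augG (D : Fin q → (Fin n →₀ ℕ)) (S : Finset (Fin q)) :
    Gs k D S 0 →ₗ[MvPolynomial (Fin n) k] (MvPolynomial (Fin n) k ⧸ monIdeal k n q D) :=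
  (Submodule.mkQ (monIdeal k n q D)) ∘ₗ (LinearMap.proj (∅ : Finset (Fin q))) ∘ₗ
    (Gs k D S 0).subtype

theorem augG_apply (D : Fin q → (Fin n →₀ ℕ)) (S : Finset (Fin q)) (y : Gs k D S 0) :
    augG k D S y = Submodule.mkQ (monIdeal k n q D) (y.1 ∅) := rfl

theorem mem_monIdeal (D : Fin q → (Fin n →₀ ℕ)) (p : MvPolynomial (Fin n) k) :
    p ∈ monIdeal k n q D ↔ ∀ a, coeff a p ≠ 0 → ∃ t, D t ≤ a := by
  have : (Set.range fun i => monomial (D i) (1 : k)) =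
      (fun s => monomial s (1 : k)) '' Set.range D := by
    rw [← Set.range_comp]; rfl
  rw [monIdeal, this, mem_ideal_span_monomial_image]
  simp

theorem augG_surj (D : Fin q → (Fin n →₀ ℕ)) {S : Finset (Fin q)} (hS : S ≠ ∅) :
    Function.Surjective (augG k D S) := by
  intro m
  obtain ⟨p, rfl⟩ := Submodule.mkQ_surjective _ m
  refine ⟨⟨Pi.single ∅ p, ?_⟩, ?_⟩
  · rw [mem_Gs]
    intro τ a ha
    by_cases h : τ = ∅
    · subst h
      simp [good, hS]
    · simp [h] at ha
  · rw [augG_apply]; simp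

theorem exact0 {D : Fin q → (Fin n →₀ ℕ)} {S : Finset (Fin q)} {j : Fin q} (hj : j ∉ S)
    (hjD : D j ≤ S.sup D) : LinearMap.range (dG k D S 0) = LinearMap.ker (augG k D S) := by
  ext ⟨y, hy⟩
  rw [LinearMap.mem_ker, augG_apply, Submodule.mkQ_apply, Submodule.Quotient.mk_eq_zero,
    mem_monIdeal]
  constructor
  · rintro ⟨⟨z, hz⟩, hzy⟩ a ha
    have e : bd (MvPolynomial (Fin n) k) z = y := congrArg Subtype.val hzy
    change coeff a (y ∅) ≠ 0 at ha
    rw [← e, bd_apply] at ha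
    rw [coeff_sum] at ha
    obtain ⟨t, -, ht⟩ := Finset.exists_ne_zero_of_sum_ne_zero ha
    have h1 : coeff a (z (insert t ∅)) ≠ 0 := by
      intro h0
      apply ht
      rw [← lcoeff_apply (R := k), map_zsmul, lcoeff_apply, h0, smul_zero]
    exact ⟨t, ((mem_Gs.1 hz) _ _ h1).2 t (by simp)⟩
  · intro h
    have hy' := mem_Gs.1 hy
    obtain ⟨z, hz, e⟩ := fill hj hjD hy (by
      intro τ a ha
      have := (hy' τ a ha).1.1
      rw [Finset.card_eq_zero] at this
      subst this
      exact h a ha) (by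
      ext1 σ
      rw [bd_apply, Pi.zero_apply]
      refine Finset.sum_eq_zero fun t _ => ?_
      have : y (insert t σ) = 0 := by
        ext a
        by_contra ha
        have := (hy' _ _ ha).1.1
        simp at this
      rw [this, smul_zero])
    exact ⟨⟨z, hz⟩, Subtype.ext e⟩

theorem exactS {D : Fin q → (Fin n →₀ ℕ)} {S : Finset (Fin q)} {j : Fin q} (hj : j ∉ S)
    (hjD : D j ≤ S.sup D) (i : ℕ) :
    LinearMap.range (dG k D S (i + 1)) = LinearMap.ker (dG k D S i) := by
  ext ⟨y, hy⟩
  rw [LinearMap.mem_ker]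
  constructor
  · rintro ⟨⟨z, hz⟩, hzy⟩
    rw [← hzy]
    exact Subtype.ext (bd_bd (MvPolynomial (Fin n) k) z)
  · intro h
    obtain ⟨z, hz, e⟩ := fill hj hjD hy (by
      intro τ a ha
      obtain ⟨⟨h1, -⟩, h2⟩ := mem_Gs.1 hy τ a ha
      obtain ⟨t, ht⟩ : τ.Nonempty := by rw [← Finset.card_pos]; omega
      exact ⟨t, h2 t ht⟩) (congrArg Subtype.val h)
    exact ⟨⟨z, hz⟩, Subtype.ext e⟩

open Classical in
theorem card_good (S : Finset (Fin q)) (i : ℕ) :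
    Fintype.card {τ // good S i τ} =
      q.choose i - (if S.card ≤ i then (q - S.card).choose (i - S.card) else 0) := by
  have h1 : Fintype.card {τ // good S i τ} =
      (((Finset.univ : Finset (Fin q)).powersetCard i).filter fun τ => ¬ S ⊆ τ).card := by
    refine Fintype.card_of_subtype _ fun τ => ?_
    rw [Finset.mem_filter, Finset.mem_powersetCard]
    simp [good]
  have h2 := Finset.card_filter_add_card_filter_not
    (s := (Finset.univ : Finset (Fin q)).powersetCard i) (fun τ => S ⊆ τ)
  rw [Finset.card_powersetCard, Finset.card_univ, Fintype.card_fin] at h2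
  have h3 : (((Finset.univ : Finset (Fin q)).powersetCard i).filter fun τ => S ⊆ τ).card =
      if S.card ≤ i then (q - S.card).choose (i - S.card) else 0 := by
    split_ifs with hi
    · have : (q - S.card).choose (i - S.card) = (Sᶜ.powersetCard (i - S.card)).card := by
        rw [Finset.card_powersetCard, Finset.card_compl, Fintype.card_fin]
      rw [this]
      refine Finset.card_bij' (fun τ _ => τ \ S) (fun τ _ => τ ∪ S) ?_ ?_ ?_ ?_
      · intro τ hτ
        simp only [Finset.mem_filter, Finset.mem_powersetCard] at hτ ⊢
        refine ⟨fun t ht => ?_, ?_⟩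
        · simp at ht ⊢; exact ht.2
        · rw [Finset.card_sdiff_of_subset hτ.2, hτ.1.2]
      · intro τ hτ
        simp only [Finset.mem_filter, Finset.mem_powersetCard] at hτ ⊢
        refine ⟨⟨Finset.subset_univ _, ?_⟩, Finset.subset_union_right⟩
        rw [Finset.card_union_of_disjoint, hτ.2]
        · omega
        · exact Finset.disjoint_left.2 fun t ht => by simpa using hτ.1 ht
      · intro τ hτ
        simp only [Finset.mem_filter] at hτ
        exact Finset.sdiff_union_of_subset hτ.2
      · intro τ hτ
        simp only [Finset.mem_powersetCard] at hτ
        ext t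
        have := @hτ.1 t
        simp at this ⊢
        tauto
    · rw [Finset.card_eq_zero, Finset.filter_eq_empty_iff]
      intro τ hτ hS
      have := Finset.card_le_card hS
      rw [(Finset.mem_powersetCard.1 hτ).2] at this
      exact hi this
  omega

end Pivot

end ScarfAux

/-- **A bound on Betti numbers.**
Suppose `s := scarf(I) < ∞`.  Then for every minimal free resolution `F` of
`Q/I` over `Q` and every `i`,
`β_i^Q(Q/I) = rank F_i ≤ binom(q,i) − binom(q−s, i−s)`
(with `binom(q−s, i−s) = 0` when `i < s`). -/
theorem betti_le_of_scarf {k : Type*} [Field k] {n q : ℕ}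
    (D : Fin q → (Fin n →₀ ℕ))
    (hne : ∀ i : Fin q, D i ≠ 0)
    (hmin : ∀ i j : Fin q, i ≠ j → ¬ lcmMono k n q D {i} ∣ lcmMono k n q D {j})
    (hfin : (scarfSet k n q D).Nonempty)
    (F : MinimalFreeResolution (MvPolynomial (Fin n) k)
      (Ideal.span (Set.range (X : Fin n → MvPolynomial (Fin n) k)))
      (MvPolynomial (Fin n) k ⧸ monIdeal k n q D)) :
    ∀ i : ℕ, F.rk i ≤
      q.choose i -
        (if sInf (scarfSet k n q D) ≤ i then
          (q - sInf (scarfSet k n q D)).choose (i - sInf (scarfSet k n q D))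
        else 0) := by
  classical
  intro i
  obtain ⟨S, τ', hne', hcard, hl⟩ := Nat.sInf_mem hfin
  have hsup : S.sup D = τ'.sup D := by
    simpa [lcmMono, monomial_eq_monomial_iff] using hl
  have hnot : ¬ τ' ⊆ S := by
    intro hsub
    have h1 : τ'.card ∈ scarfSet k n q D := ⟨τ', S, hne'.symm, rfl, hl.symm⟩
    have h2 := Nat.sInf_le h1
    rw [← hcard] at h2
    exact hne' (Finset.eq_of_subset_of_card_le hsub h2).symm
  obtain ⟨j, hj', hj⟩ := Finset.not_subset.1 hnot
  have hjD : D j ≤ S.sup D := by rw [hsup]; exact Finset.le_sup hj'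
  have hS : S ≠ ∅ := by
    rintro rfl
    apply hne j
    exact le_antisymm hjD zero_le
  have : ∀ i, Module.Projective (MvPolynomial (Fin n) k) (ScarfAux.Gs k D S i) :=
    fun i => Module.Projective.of_equiv (ScarfAux.eqv k D S i)
  obtain ⟨f, g, -, -, -, -, h⟩ := ScarfAux.comparison F (fun i => ScarfAux.Gs k D S i)
    (ScarfAux.dG k D S) (ScarfAux.augG k D S) (ScarfAux.augG_surj D hS)
    (ScarfAux.exact0 hj hjD) (ScarfAux.exactS hj hjD) i
  rw [← hcard, ← ScarfAux.card_good]
  refine ScarfAux.rank_le (constantCoeff (R := k) (σ := Fin n)) ?_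
    ((ScarfAux.eqv k D S i).symm.toLinearMap ∘ₗ f) (g ∘ₗ (ScarfAux.eqv k D S i).toLinearMap)
    (fun x => by simpa using h x)
  intro a ha
  have : Ideal.span (Set.range (X : Fin n → MvPolynomial (Fin n) k)) ≤
      RingHom.ker (constantCoeff (R := k) (σ := Fin n)) := by
    rw [Ideal.span_le]
    rintro _ ⟨t, rfl⟩
    simp
  exact this ha
end

section
/- If scarf(I) = q − 1, then the Betti numbers of Q/I over Q are β_i^Q(Q/I) = binom(q,i) for all 0 ≤ i ≤ q−2, β_{q−1}^Q(Q/I) = q−1, and β_q^Q(Q/I) = 0; that is, any minimal free resolution F of Q/I over Q satisfies rank F_i = binom(q,i) for 0 ≤ i ≤ q−2, rank F_{q−1} = q−1, and F_q = 0. -/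
open MvPolynomial Finset

/-- comparison data -/
structure FRes (R : Type*) [CommRing R] (mR : Ideal R)
    (M : Type*) [AddCommGroup M] [Module R M] where
  A : ℕ → Type*
  [grp : ∀ i, AddCommGroup (A i)]
  [mod : ∀ i, Module R (A i)]
  ι : ℕ → Type
  [fin : ∀ i, Fintype (ι i)]
  b : ∀ i, Module.Basis (ι i) R (A i)
  d : ∀ i : ℕ, A (i+1) →ₗ[R] A i
  aug : A 0 →ₗ[R] M
  aug_surj : ∀ m, ∃ x, aug x = m
  ex0 : ∀ x, aug x = 0 → ∃ y, d 0 y = x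
  aug_d : ∀ x, aug (d 0 x) = 0
  ex : ∀ i x, d i x = 0 → ∃ y, d (i+1) y = x
  dd : ∀ i x, d i (d (i+1) x) = 0
  minl : ∀ i x, d i x ∈ mR • (⊤ : Submodule R (A i))

attribute [instance] FRes.grp FRes.mod FRes.fin

theorem basis_lift {R P N N' ι : Type*} [CommRing R] [AddCommGroup P] [Module R P]
    [AddCommGroup N] [Module R N] [AddCommGroup N'] [Module R N']
    (b : Module.Basis ι R P) (f : P →ₗ[R] N) (d : N' →ₗ[R] N)
    (h : ∀ x, ∃ y, d y = f x) : ∃ g : P →ₗ[R] N', ∀ x, d (g x) = f x := by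
  choose c hc using h
  refine ⟨b.constr R (fun i => c (b i)), fun x => ?_⟩
  have : d ∘ₗ (b.constr R (fun i => c (b i))) = f := by
    apply b.ext
    intro i
    simp [hc]
  exact LinearMap.congr_fun this x

section
variable {R : Type*} [CommRing R] {mR : Ideal R}
    {M : Type*} [AddCommGroup M] [Module R M]

theorem map_mem_smul_top {P N : Type*} [AddCommGroup P] [Module R P]
    [AddCommGroup N] [Module R N] (f : P →ₗ[R] N) {x : P}
    (hx : x ∈ mR • (⊤ : Submodule R P)) : f x ∈ mR • (⊤ : Submodule R N) := by
  have : f x ∈ (mR • (⊤ : Submodule R P)).map f := Submodule.mem_map_of_mem hx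
  rw [Submodule.map_smul''] at this
  exact Submodule.smul_mono le_rfl le_top this

/-- half of the inductive comparison -/
def Half (F : FRes R mR M) (G : FRes R mR M) (i : ℕ)
    (f : F.A i →ₗ[R] G.A i) (g : G.A i →ₗ[R] F.A i) : Prop :=
  (∀ x, ∃ y, G.d i y = f (F.d i x)) ∧
  (∃ h : F.A i →ₗ[R] F.A (i+1),
    ∀ x, g (f (F.d i x)) - F.d i x - F.d i (h (F.d i x)) = 0) ∧
  (∀ x, g (f x) - x ∈ mR • (⊤ : Submodule R (F.A i)))

theorem half_zero (F : FRes R mR M) (G : FRes R mR M)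
    (f : F.A 0 →ₗ[R] G.A 0) (g : G.A 0 →ₗ[R] F.A 0)
    (hf : ∀ x, G.aug (f x) = F.aug x) (hg : ∀ x, F.aug (g x) = G.aug x) :
    Half F G 0 f g := by
  obtain ⟨h, hh⟩ := basis_lift (F.b 0) (g ∘ₗ f - LinearMap.id) (F.d 0) (by
    intro x
    apply F.ex0
    simp [hg, hf])
  simp only [LinearMap.sub_apply, LinearMap.comp_apply, LinearMap.id_apply] at hh
  refine ⟨fun x => G.ex0 _ (by rw [hf, F.aug_d]), ⟨h, fun x => ?_⟩, fun x => ?_⟩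
  · rw [hh]; simp
  · rw [← hh]; exact F.minl _ _

theorem half_succ (F : FRes R mR M) (G : FRes R mR M) (i : ℕ)
    (f : F.A i →ₗ[R] G.A i) (g : G.A i →ₗ[R] F.A i) (H : Half F G i f g)
    (f' : F.A (i+1) →ₗ[R] G.A (i+1)) (g' : G.A (i+1) →ₗ[R] F.A (i+1))
    (hf : ∀ x, G.d i (f' x) = f (F.d i x)) (hg : ∀ x, F.d i (g' x) = g (G.d i x)) :
    Half F G (i+1) f' g' := by
  obtain ⟨-, ⟨h, hh⟩, -⟩ := H
  obtain ⟨h1, hh1⟩ := basis_lift (F.b (i+1)) (g' ∘ₗ f' - LinearMap.id - h ∘ₗ F.d i)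
    (F.d (i+1)) (by
    intro x
    apply F.ex
    simp only [LinearMap.sub_apply, LinearMap.comp_apply, LinearMap.id_apply, map_sub, hg, hf, hh])
  simp only [LinearMap.sub_apply, LinearMap.comp_apply, LinearMap.id_apply] at hh1
  refine ⟨fun x => G.ex _ _ (by rw [hf, F.dd, map_zero]), ⟨h1, fun x => ?_⟩, fun x => ?_⟩
  · rw [hh1, F.dd]; simp
  · have : g' (f' x) - x = F.d (i+1) (h1 x) + h (F.d i x) := by rw [hh1]; abel
    rw [this]
    exact add_mem (F.minl _ _) (map_mem_smul_top h (F.minl _ _))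

theorem exists_halves (F : FRes R mR M) (G : FRes R mR M) (i : ℕ) :
    ∃ f g, Half F G i f g ∧ Half G F i g f := by
  induction i with
  | zero =>
    obtain ⟨f, hf⟩ := basis_lift (F.b 0) F.aug G.aug (fun x => G.aug_surj _)
    obtain ⟨g, hg⟩ := basis_lift (G.b 0) G.aug F.aug (fun x => F.aug_surj _)
    exact ⟨f, g, half_zero F G f g hf hg, half_zero G F g f hg hf⟩
  | succ i ih =>
    obtain ⟨f, g, H1, H2⟩ := ih
    obtain ⟨f', hf⟩ := basis_lift (F.b (i+1)) (f ∘ₗ F.d i) (G.d i) H1.1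
    obtain ⟨g', hg⟩ := basis_lift (G.b (i+1)) (g ∘ₗ G.d i) (F.d i) H2.1
    exact ⟨f', g', half_succ F G i f g H1 f' g' hf hg, half_succ G F i g f H2 g' f' hg hf⟩

theorem repr_mem_of_smul_top {P ι : Type*} [AddCommGroup P] [Module R P]
    (b : Module.Basis ι R P) {x : P} (hx : x ∈ mR • (⊤ : Submodule R P)) (t : ι) :
    b.repr x t ∈ mR := by
  have := map_mem_smul_top (b.coord t) hx
  simpa using this

theorem matrix_quot_one {P N ι κ : Type*} [AddCommGroup P] [Module R P]
    [AddCommGroup N] [Module R N] [Fintype ι] [Fintype κ] [DecidableEq ι] [DecidableEq κ]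
    (b : Module.Basis ι R P) (c : Module.Basis κ R N)
    (f : P →ₗ[R] N) (g : N →ₗ[R] P)
    (h : ∀ x, g (f x) - x ∈ mR • (⊤ : Submodule R P)) :
    (LinearMap.toMatrix c b g).map (Ideal.Quotient.mk mR) *
      (LinearMap.toMatrix b c f).map (Ideal.Quotient.mk mR) = 1 := by
  rw [← Matrix.map_mul, ← LinearMap.toMatrix_comp]
  ext i j
  have := repr_mem_of_smul_top b (h (b j)) i
  rw [map_sub, Finsupp.sub_apply, ← Ideal.Quotient.mk_eq_mk_iff_sub_mem] at this
  simp only [Matrix.map_apply, LinearMap.toMatrix_apply, LinearMap.comp_apply]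
  rw [this, b.repr_self, Matrix.one_apply, Finsupp.single_apply]
  by_cases hij : i = j
  · simp [hij]
  · simp [hij, Ne.symm hij]

theorem FRes.card_eq (hm : mR ≠ ⊤) (F : FRes R mR M) (G : FRes R mR M) (i : ℕ) :
    Fintype.card (F.ι i) = Fintype.card (G.ι i) := by
  classical
  have : Nontrivial (R ⧸ mR) := Ideal.Quotient.nontrivial_iff.mpr hm
  obtain ⟨f, g, H1, H2⟩ := exists_halves F G i
  have e1 := matrix_quot_one (G.b i) (F.b i) g f H2.2.2
  have e2 := matrix_quot_one (F.b i) (G.b i) f g H1.2.2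
  exact Matrix.square_of_invertible _ _ e2 e1
end

/-! signs -/
def sgn {q : ℕ} (j : Fin q) (σ : Finset (Fin q)) : ℤ := (-1) ^ (σ.filter (· < j)).card

theorem sgn_mul_self {q : ℕ} (j : Fin q) (σ : Finset (Fin q)) : sgn j σ * sgn j σ = 1 := by
  unfold sgn; rw [← mul_pow]; simp

theorem sgn_insert_self {q : ℕ} (j : Fin q) (σ : Finset (Fin q)) :
    sgn j (insert j σ) = sgn j σ := by
  unfold sgn; rw [Finset.filter_insert]; simp

theorem sgn_insert {q : ℕ} (i j : Fin q) (σ : Finset (Fin q)) (hj : j ∉ σ) :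
    sgn i (insert j σ) = if j < i then - sgn i σ else sgn i σ := by
  unfold sgn; rw [Finset.filter_insert]
  split_ifs with h
  · rw [Finset.card_insert_of_notMem (by simp [hj]), pow_succ]; simp
  · rfl

theorem sgn_swap {q : ℕ} (i j : Fin q) (σ : Finset (Fin q)) (hij : i ≠ j) (hi : i ∉ σ)
    (hj : j ∉ σ) : sgn j σ * sgn i (insert j σ) = - (sgn i σ * sgn j (insert i σ)) := by
  rw [sgn_insert _ _ _ hj, sgn_insert _ _ _ hi]
  rcases lt_or_gt_of_ne hij with h | h
  · simp [h, h.not_gt]; ring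
  · simp [h, h.not_gt]; ring

/-- simplicial boundary -/
def bd {q : ℕ} {A : Type*} [AddCommGroup A] (v : Finset (Fin q) → A) (σ : Finset (Fin q)) : A :=
  ∑ j ∈ σᶜ, sgn j σ • v (insert j σ)

theorem bd_bd {q : ℕ} {A : Type*} [AddCommGroup A] (v : Finset (Fin q) → A) :
    bd (bd v) = 0 := by
  ext σ
  simp only [bd, Finset.smul_sum, Pi.zero_apply]
  rw [Finset.sum_sigma']
  refine Finset.sum_involution (fun x _ => ⟨x.2, x.1⟩) ?_ ?_ ?_ ?_
  · rintro ⟨j, i⟩ h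
    simp only [mem_sigma, mem_compl, mem_insert, not_or] at h
    simp only [smul_smul]
    rw [sgn_swap i j σ h.2.1 h.2.2 h.1, Finset.insert_comm i j]
    simp
  · rintro ⟨j, i⟩ h _ he
    simp only [mem_sigma, mem_compl, mem_insert, not_or] at h
    simp only [Sigma.mk.injEq] at he
    exact h.2.1 he.1
  · rintro ⟨j, i⟩ h
    simp only [mem_sigma, mem_compl, mem_insert, not_or] at h ⊢
    exact ⟨h.2.2, Ne.symm h.2.1, h.1⟩
  · rintro ⟨j, i⟩ h
    rfl

/-- contraction -/
def ctr {q : ℕ} {A : Type*} [AddCommGroup A] (j : Fin q) (v : Finset (Fin q) → A)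
    (σ : Finset (Fin q)) : A := if j ∈ σ then sgn j σ • v (σ.erase j) else 0

theorem bd_ctr {q : ℕ} {A : Type*} [AddCommGroup A] (j : Fin q) (v : Finset (Fin q) → A)
    (hv : bd v = 0) : bd (ctr j v) = v := by
  ext σ
  by_cases hj : j ∈ σ
  · obtain ⟨ρ, hρ, rfl⟩ : ∃ ρ, j ∉ ρ ∧ insert j ρ = σ :=
      ⟨σ.erase j, by simp, Finset.insert_erase hj⟩
    have h0 : bd v ρ = 0 := by rw [hv]; rfl
    have hc : ρᶜ = insert j (insert j ρ)ᶜ := by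
      ext x; by_cases hx : x = j
      · subst hx; simp [hρ]
      · simp [hx]
    unfold bd at h0 ⊢
    rw [hc, Finset.sum_insert (by simp)] at h0
    have : ∑ i ∈ (insert j ρ)ᶜ, sgn i (insert j ρ) • ctr j v (insert i (insert j ρ)) =
       - (sgn j ρ • ∑ i ∈ (insert j ρ)ᶜ, sgn i ρ • v (insert i ρ)) := by
      rw [Finset.smul_sum, ← Finset.sum_neg_distrib]
      refine Finset.sum_congr rfl fun i hi => ?_
      simp only [mem_compl, mem_insert, not_or] at hi
      have e1 : (insert i (insert j ρ)).erase j = insert i ρ := by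
        rw [Finset.insert_comm, Finset.erase_insert]
        simp [hρ, Ne.symm hi.1]
      unfold ctr
      rw [if_pos (by simp), e1, smul_smul, smul_smul, Finset.insert_comm i j,
        sgn_insert_self, ← neg_smul]
      congr 1
      have h1 := sgn_swap i j ρ hi.1 hi.2 hρ
      have h2 := sgn_mul_self j ρ
      have h3 := sgn_mul_self j (insert i ρ)
      have h4 : sgn i (insert j ρ) = - (sgn j ρ * sgn i ρ * sgn j (insert i ρ)) := by
        linear_combination sgn j ρ * h1 - sgn i (insert j ρ) * h2
      rw [h4]; linear_combination - sgn j ρ * sgn i ρ * h3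
    rw [this, ← neg_eq_of_add_eq_zero_right h0, smul_neg, neg_neg, smul_smul, sgn_mul_self, one_smul]
  · unfold bd
    rw [Finset.sum_eq_single j]
    · unfold ctr
      rw [if_pos (by simp), Finset.erase_insert hj, smul_smul, sgn_insert_self, sgn_mul_self,
        one_smul]
    · intro i _ hij
      unfold ctr
      rw [if_neg (by simp [hj, Ne.symm hij]), smul_zero]
    · simp [hj]

section
variable {k : Type*} [Field k] {n q : ℕ} (D : Fin q → (Fin n →₀ ℕ)) (s : Fin q)

theorem coeff_bd (v : Finset (Fin q) → MvPolynomial (Fin n) k) (α : Fin n →₀ ℕ)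
    (σ : Finset (Fin q)) : coeff α (bd v σ) = bd (fun τ => coeff α (v τ)) σ := by
  unfold bd
  rw [coeff_sum]
  refine Finset.sum_congr rfl fun j _ => ?_
  exact map_zsmul (coeffAddMonoidHom α) _ _

/-- indices of the pivot complex -/
abbrev Idx (s : Fin q) (i : ℕ) : Type :=
  {τ : Finset (Fin q) // ¬ univ.erase s ⊆ τ ∧ τ.card = i}

/-- embedding into the simplicial complex -/
noncomputable def phi (k : Type*) [Field k] (D : Fin q → (Fin n →₀ ℕ)) (s : Fin q) (i : ℕ) :
    (Idx s i → MvPolynomial (Fin n) k) →ₗ[MvPolynomial (Fin n) k]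
    (Finset (Fin q) → MvPolynomial (Fin n) k) where
  toFun u τ := if h : ¬ univ.erase s ⊆ τ ∧ τ.card = i then
    monomial (τ.sup D) (1 : k) * u ⟨τ, h⟩ else 0
  map_add' u v := by
    ext1 τ
    simp only [Pi.add_apply]
    split_ifs
    · exact mul_add _ _ _
    · simp
  map_smul' r u := by
    ext1 τ
    simp only [Pi.smul_apply, RingHom.id_apply, smul_eq_mul]
    split_ifs
    · exact mul_left_comm _ _ _
    · simp

theorem phi_apply (i : ℕ) (u : Idx s i → MvPolynomial (Fin n) k) (τ : Finset (Fin q)) :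
    phi k D s i u τ = if h : ¬ univ.erase s ⊆ τ ∧ τ.card = i then
    monomial (τ.sup D) (1 : k) * u ⟨τ, h⟩ else 0 := rfl

theorem phi_inj (i : ℕ) : Function.Injective (phi k D s i) := by
  intro u v h
  ext1 ⟨τ, hτ⟩
  have := congrFun h τ
  rw [phi_apply, phi_apply, dif_pos hτ, dif_pos hτ] at this
  refine mul_left_cancel₀ ?_ this
  simp [monomial_eq_zero]

/-- the terms of the pivot complex -/
noncomputable def Gm (k : Type*) [Field k] (D : Fin q → (Fin n →₀ ℕ)) (s : Fin q) (i : ℕ) :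
    Submodule (MvPolynomial (Fin n) k) (Finset (Fin q) → MvPolynomial (Fin n) k) :=
  LinearMap.range (phi k D s i)

theorem mem_Gm (i : ℕ) (v : Finset (Fin q) → MvPolynomial (Fin n) k) :
    v ∈ Gm k D s i ↔ ∀ τ α, coeff α (v τ) ≠ 0 →
      (¬ univ.erase s ⊆ τ ∧ τ.card = i) ∧ τ.sup D ≤ α := by
  constructor
  · rintro ⟨u, rfl⟩ τ α h
    rw [phi_apply] at h
    split_ifs at h with h1
    · refine ⟨h1, ?_⟩
      rw [coeff_monomial_mul'] at h
      by_contra h2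
      simp [h2] at h
    · simp at h
  · intro h
    refine ⟨fun τ => (v τ.1).divMonomial (τ.1.sup D), ?_⟩
    ext τ α
    rw [phi_apply]
    split_ifs with h1
    · rw [coeff_monomial_mul']
      split_ifs with h2
      · rw [coeff_divMonomial, one_mul, add_tsub_cancel_of_le h2]
      · by_contra h3
        exact h2 (h τ α (Ne.symm h3)).2
    · by_contra h3
      exact h1 (h τ α (by simpa using Ne.symm h3)).1

/-- boundary, linear version -/
noncomputable def bdL (k : Type*) [Field k] (n q : ℕ) :
    (Finset (Fin q) → MvPolynomial (Fin n) k) →ₗ[MvPolynomial (Fin n) k]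
    (Finset (Fin q) → MvPolynomial (Fin n) k) where
  toFun := bd
  map_add' u v := by
    ext1 σ
    simp [bd, Finset.sum_add_distrib]
  map_smul' r u := by
    ext1 σ
    simp only [bd, Pi.smul_apply, RingHom.id_apply, Finset.smul_sum]
    exact Finset.sum_congr rfl fun j _ => smul_comm _ _ _

/-- coordinates of the boundary -/
noncomputable def dcoord (i : ℕ) (u : Idx s (i+1) → MvPolynomial (Fin n) k) (σ : Idx s i) :
    MvPolynomial (Fin n) k :=
  ∑ j ∈ σ.1ᶜ, if h : ¬ univ.erase s ⊆ insert j σ.1 ∧ (insert j σ.1).card = i + 1 then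
    sgn j σ.1 • (monomial ((insert j σ.1).sup D - σ.1.sup D) (1 : k) * u ⟨_, h⟩) else 0

theorem phi_dcoord (i : ℕ) (u : Idx s (i+1) → MvPolynomial (Fin n) k) :
    phi k D s i (dcoord D s i u) = bd (phi k D s (i+1) u) := by
  ext1 σ
  rw [phi_apply]
  split_ifs with hσ
  · unfold dcoord bd
    rw [Finset.mul_sum]
    refine Finset.sum_congr rfl fun j hj => ?_
    rw [phi_apply]
    split_ifs with h
    · rw [mul_smul_comm, ← mul_assoc, monomial_mul, one_mul,
        add_tsub_cancel_of_le (Finset.sup_mono (Finset.subset_insert _ _))]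
    · simp
  · unfold bd
    symm
    refine Finset.sum_eq_zero fun j hj => ?_
    rw [phi_apply, dif_neg, smul_zero]
    rintro ⟨h1, h2⟩
    refine hσ ⟨fun h => h1 (h.trans (Finset.subset_insert _ _)), ?_⟩
    rw [Finset.card_insert_of_notMem (by simpa using hj)] at h2
    omega

theorem bd_mem (i : ℕ) (v : Finset (Fin q) → MvPolynomial (Fin n) k)
    (hv : v ∈ Gm k D s (i+1)) : bd v ∈ Gm k D s i := by
  obtain ⟨u, rfl⟩ := hv
  exact ⟨_, phi_dcoord D s i u⟩

theorem pivot_core (hs : D s ≤ (univ.erase s).sup D) (i : ℕ)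
    (v : Finset (Fin q) → MvPolynomial (Fin n) k)
    (hv : v ∈ Gm k D s i) (hb : bd v = 0)
    (hα : ∀ τ α, coeff α (v τ) ≠ 0 → ∃ j, D j ≤ α) :
    ∃ y ∈ Gm k D s (i+1), bd y = v := by
  classical
  rw [mem_Gm] at hv
  obtain ⟨c, hc1, hc2⟩ : ∃ c : (Fin n →₀ ℕ) → Fin q,
      (∀ α, (∃ j, D j ≤ α) → D (c α) ≤ α) ∧ ∀ α, D s ≤ α → c α = s := by
    have : ∀ α : Fin n →₀ ℕ, ∃ j : Fin q, ((∃ j, D j ≤ α) → D j ≤ α) ∧ (D s ≤ α → j = s) := by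
      intro α
      by_cases h : D s ≤ α
      · exact ⟨s, fun _ => h, fun _ => rfl⟩
      · by_cases h2 : ∃ j, D j ≤ α
        · exact ⟨h2.choose, fun _ => h2.choose_spec, fun h' => absurd h' h⟩
        · exact ⟨s, fun h' => absurd h' h2, fun _ => rfl⟩
    choose c hc using this
    exact ⟨c, fun α => (hc α).1, fun α => (hc α).2⟩
  have hy : ∀ σ : Finset (Fin q), ∃ p : MvPolynomial (Fin n) k,
      ∀ α, coeff α p = ctr (c α) (fun τ => coeff α (v τ)) σ := by
    intro σ
    refine ⟨∑ j ∈ σ, ∑ β ∈ (v (σ.erase j)).support with c β = j,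
      monomial β (sgn j σ • coeff β (v (σ.erase j))), fun α => ?_⟩
    simp only [coeff_sum, coeff_monomial, Finset.sum_ite_eq', mem_filter, mem_support_iff]
    unfold ctr
    have : ∀ j, (if coeff α (v (σ.erase j)) ≠ 0 ∧ c α = j then
        sgn j σ • coeff α (v (σ.erase j)) else 0) =
        if c α = j then sgn j σ • coeff α (v (σ.erase j)) else 0 := by
      intro j
      by_cases h : coeff α (v (σ.erase j)) = 0 <;> simp [h]
    simp only [this, Finset.sum_ite_eq]
  choose y hy using hy
  refine ⟨y, ?_, ?_⟩
  · rw [mem_Gm]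
    intro σ α h
    rw [hy] at h
    unfold ctr at h
    split_ifs at h with h1
    · have h2 : coeff α (v (σ.erase (c α))) ≠ 0 := by
        intro h3; simp [h3] at h
      obtain ⟨⟨h3, h4⟩, h5⟩ := hv _ _ h2
      have h6 := hc1 α (hα _ _ h2)
      have h7 : σ.sup D ≤ α := by
        rw [← Finset.insert_erase h1, Finset.sup_insert]
        exact sup_le h6 h5
      refine ⟨⟨fun hS => ?_, ?_⟩, h7⟩
      · have h8 := hc2 α (hs.trans ((Finset.sup_mono hS).trans h7))
        rw [h8] at h3
        apply h3
        intro x hx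
        exact Finset.mem_erase.2 ⟨(Finset.mem_erase.1 hx).1, hS hx⟩
      · rw [← h4, Finset.card_erase_add_one h1]
    · exact absurd rfl h
  · ext σ α
    rw [coeff_bd]
    have e : (fun τ => coeff α (y τ)) = ctr (c α) (fun τ => coeff α (v τ)) := by
      ext τ; exact hy τ α
    rw [e, bd_ctr]
    ext τ
    rw [← coeff_bd, hb]; simp

theorem mem_monIdeal (p : MvPolynomial (Fin n) k) :
    p ∈ monIdeal k n q D ↔ ∀ α, coeff α p ≠ 0 → ∃ j, D j ≤ α := by
  have : (Set.range fun i => monomial (D i) (1 : k)) =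
    (fun s => monomial s (1 : k)) '' Set.range D := by
    rw [← Set.range_comp]; rfl
  unfold monIdeal
  rw [this, mem_ideal_span_monomial_image]
  simp

theorem monomial_mem_max (a : Fin n →₀ ℕ) (ha : a ≠ 0) : monomial a (1 : k) ∈
    Ideal.span (Set.range (X : Fin n → MvPolynomial (Fin n) k)) := by
  rw [← Set.image_univ, mem_ideal_span_X_image]
  intro m hm
  have : m = a := by
    have := MvPolynomial.support_monomial_subset hm
    simpa using this
  subst this
  obtain ⟨i, hi⟩ := Finsupp.ne_iff.1 ha
  exact ⟨i, trivial, by simpa using hi⟩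

theorem maxIdeal_ne_top : Ideal.span (Set.range (X : Fin n → MvPolynomial (Fin n) k)) ≠ ⊤ := by
  rw [Ideal.ne_top_iff_one, ← Set.image_univ, mem_ideal_span_X_image]
  intro h
  obtain ⟨i, -, hi⟩ := h 0 (by simp)
  simp at hi

/-- the pivot resolution -/
noncomputable def pivotRes (hs : D s ≤ (univ.erase s).sup D)
    (hstrict : ∀ (σ : Finset (Fin q)) (j : Fin q), j ∉ σ → ¬ univ.erase s ⊆ insert j σ →
      (insert j σ).sup D ≠ σ.sup D) (hS : univ.erase s ≠ ∅) :
    FRes (MvPolynomial (Fin n) k) (Ideal.span (Set.range (X : Fin n → MvPolynomial (Fin n) k)))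
      (MvPolynomial (Fin n) k ⧸ monIdeal k n q D) where
  A i := Gm k D s i
  ι i := Idx s i
  b i := (Pi.basisFun (MvPolynomial (Fin n) k) (Idx s i)).map
    (LinearEquiv.ofInjective (phi k D s i) (phi_inj D s i))
  d i := (bdL k n q).restrict (bd_mem D s i)
  aug := (Submodule.mkQ _) ∘ₗ (LinearMap.proj ∅) ∘ₗ (Gm k D s 0).subtype
  aug_surj m := by
    obtain ⟨p, rfl⟩ := Submodule.mkQ_surjective _ m
    refine ⟨⟨phi k D s 0 (fun _ => p), ⟨_, rfl⟩⟩, ?_⟩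
    simp only [LinearMap.comp_apply, Submodule.subtype_apply, LinearMap.proj_apply]
    rw [phi_apply, dif_pos ⟨by simpa [Finset.subset_empty] using hS, rfl⟩]
    have e : monomial ((∅ : Finset (Fin q)).sup D) (1 : k) = 1 := rfl
    rw [e, one_mul]
  ex0 := by
    rintro ⟨v, hv⟩ h
    simp only [LinearMap.comp_apply, Submodule.subtype_apply, LinearMap.proj_apply,
      Submodule.mkQ_apply, Submodule.Quotient.mk_eq_zero] at h
    rw [mem_monIdeal] at h
    have hv' := (mem_Gm D s 0 v).1 hv
    obtain ⟨y, hy, e⟩ := pivot_core D s hs 0 v hv (by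
      ext σ α
      simp only [bd, Pi.zero_apply, coeff_zero]
      rw [coeff_sum]
      refine Finset.sum_eq_zero fun j hj => ?_
      have : v (insert j σ) = 0 := by
        ext β
        by_contra h'
        have := (hv' _ _ h').1.2
        simp at this
      rw [this]; simp) (by
      intro τ α h'
      have := (hv' _ _ h').1.2
      rw [Finset.card_eq_zero] at this
      subst this
      exact h α h')
    exact ⟨⟨y, hy⟩, Subtype.ext e⟩
  aug_d := by
    rintro ⟨y, hy⟩
    simp only [LinearMap.comp_apply, Submodule.subtype_apply, LinearMap.proj_apply,
      Submodule.mkQ_apply, Submodule.Quotient.mk_eq_zero]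
    change bd y ∅ ∈ _
    unfold bd
    refine sum_mem fun j _ => zsmul_mem ?_ _
    rw [mem_monIdeal]
    intro α h
    have := ((mem_Gm D s _ y).1 hy _ _ h).2
    exact ⟨j, by simpa using this⟩
  ex i := by
    rintro ⟨v, hv⟩ h
    have hb : bd v = 0 := congrArg Subtype.val h
    have hv' := (mem_Gm D s _ v).1 hv
    obtain ⟨y, hy, e⟩ := pivot_core D s hs (i+1) v hv hb (by
      intro τ α h'
      obtain ⟨⟨_, h1⟩, h2⟩ := hv' _ _ h'
      obtain ⟨j, hj⟩ : τ.Nonempty := by rw [← Finset.card_pos]; omega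
      exact ⟨j, (Finset.le_sup hj).trans h2⟩)
    exact ⟨⟨y, hy⟩, Subtype.ext e⟩
  dd i := by
    rintro ⟨y, hy⟩
    exact Subtype.ext (bd_bd y)
  minl i := by
    rintro ⟨_, u, rfl⟩
    have e : (bdL k n q).restrict (bd_mem D s i) ⟨_, u, rfl⟩ =
        (LinearEquiv.ofInjective (phi k D s i) (phi_inj D s i)).toLinearMap (dcoord D s i u) :=
      Subtype.ext (phi_dcoord D s i u).symm
    rw [e]
    apply map_mem_smul_top
    have e2 := (Pi.basisFun (MvPolynomial (Fin n) k) (Idx s i)).sum_repr (dcoord D s i u)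
    rw [← e2]
    refine sum_mem fun σ _ => Submodule.smul_mem_smul ?_ trivial
    rw [Pi.basisFun_repr]
    unfold dcoord
    refine sum_mem fun j hj => ?_
    split_ifs with h
    · refine zsmul_mem (Ideal.mul_mem_right _ _ (monomial_mem_max _ ?_)) _
      intro h0
      exact hstrict σ.1 j (by simpa using hj) h.1
        (le_antisymm (tsub_eq_zero_iff_le.1 h0) (Finset.sup_mono (Finset.subset_insert _ _)))
    · exact zero_mem _

/-- conversion of the given resolution -/
noncomputable def ofMin {R : Type*} [CommRing R] {mR : Ideal R}
    {M : Type*} [AddCommGroup M] [Module R M] (F : MinimalFreeResolution R mR M) :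
    FRes R mR M where
  A i := Fin (F.rk i) →₀ R
  ι i := Fin (F.rk i)
  b i := Finsupp.basisSingleOne
  d := F.d
  aug := F.aug
  aug_surj := F.aug_surjective
  ex0 x hx := by
    have : x ∈ LinearMap.range (F.d 0) := by rw [F.exact_zero]; exact hx
    exact this
  aug_d x := by
    have : F.d 0 x ∈ LinearMap.ker F.aug := by rw [← F.exact_zero]; exact ⟨x, rfl⟩
    exact this
  ex i x hx := by
    have : x ∈ LinearMap.range (F.d (i+1)) := by rw [F.exact_succ]; exact hx
    exact this
  dd i x := by
    have : F.d (i+1) x ∈ LinearMap.ker (F.d i) := by rw [← F.exact_succ]; exact ⟨x, rfl⟩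
    exact this
  minl i x := F.minimal i ⟨x, rfl⟩

theorem card_idx_lt (i : ℕ) (hi : i < q - 1) : Fintype.card (Idx s i) = q.choose i := by
  rw [Fintype.card_subtype]
  have : (univ.filter fun τ : Finset (Fin q) => ¬ univ.erase s ⊆ τ ∧ τ.card = i) =
      powersetCard i univ := by
    ext τ
    simp only [mem_filter, mem_univ, true_and, mem_powersetCard, subset_univ]
    refine ⟨fun h => h.2, fun h => ⟨fun h' => ?_, h⟩⟩
    have := Finset.card_le_card h'
    rw [Finset.card_erase_of_mem (mem_univ _), card_univ, Fintype.card_fin] at this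
    omega
  rw [this, card_powersetCard, card_univ, Fintype.card_fin]

theorem card_idx_eq (hq : 0 < q) : Fintype.card (Idx s (q - 1)) = q - 1 := by
  rw [Fintype.card_subtype]
  have : (univ.filter fun τ : Finset (Fin q) => ¬ univ.erase s ⊆ τ ∧ τ.card = q - 1) =
      (powersetCard (q - 1) univ).erase (univ.erase s) := by
    ext τ
    simp only [mem_filter, mem_univ, true_and, mem_powersetCard, subset_univ, mem_erase]
    refine and_congr_left fun h => not_congr ⟨fun h' => ?_, fun h' => h' ▸ subset_rfl⟩
    refine (Finset.eq_of_subset_of_card_le h' ?_).symm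
    rw [Finset.card_erase_of_mem (mem_univ _), card_univ, Fintype.card_fin, h]
  rw [this, card_erase_of_mem, card_powersetCard, card_univ, Fintype.card_fin]
  · rw [Nat.choose_symm (by omega : 1 ≤ q)]; simp
  · simp [Finset.card_erase_of_mem]

theorem card_idx_top : Fintype.card (Idx s q) = 0 := by
  rw [Fintype.card_eq_zero_iff]
  refine ⟨fun ⟨τ, h1, h2⟩ => h1 ?_⟩
  have : τ = univ := by
    rw [← Finset.card_eq_iff_eq_univ, h2, Fintype.card_fin]
  simp [this]
end

/-- **Betti numbers when `scarf(I) = q − 1`.**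
If `scarf(I) = q − 1` (in particular the Scarf set is nonempty), then any minimal
free resolution `F` of `Q/I` over `Q` satisfies `rank F_i = binom(q,i)` for
`0 ≤ i ≤ q−2`, `rank F_{q−1} = q−1`, and `F_q = 0`. -/
theorem betti_of_scarf_eq_q_sub_one {k : Type*} [Field k] {n q : ℕ}
    (D : Fin q → (Fin n →₀ ℕ))
    (hne : ∀ i : Fin q, D i ≠ 0)
    (hmin : ∀ i j : Fin q, i ≠ j → ¬ lcmMono k n q D {i} ∣ lcmMono k n q D {j})
    (hfin : (scarfSet k n q D).Nonempty)
    (hscarf : sInf (scarfSet k n q D) = q - 1)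
    (F : MinimalFreeResolution (MvPolynomial (Fin n) k)
      (Ideal.span (Set.range (X : Fin n → MvPolynomial (Fin n) k)))
      (MvPolynomial (Fin n) k ⧸ monIdeal k n q D)) :
    (∀ i : ℕ, i ≤ q - 2 → F.rk i = q.choose i) ∧
    F.rk (q - 1) = q - 1 ∧ F.rk q = 0 := by
  obtain ⟨τ, τ', hne', hcard, heq⟩ : q - 1 ∈ scarfSet k n q D := hscarf ▸ Nat.sInf_mem hfin
  have hinj : ∀ a b : Fin n →₀ ℕ, monomial a (1 : k) = monomial b 1 → a = b := fun a b h =>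
    monomial_left_injective one_ne_zero h
  have hbig : ∀ σ σ' : Finset (Fin q), σ ≠ σ' → σ.sup D = σ'.sup D → q - 1 ≤ σ.card := by
    intro σ σ' h1 h2
    rw [← hscarf]
    exact Nat.sInf_le ⟨σ, σ', h1, rfl, by unfold lcmMono; rw [h2]⟩
  have heq' : τ.sup D = τ'.sup D := hinj _ _ heq
  have hc' := hbig τ' τ hne'.symm heq'.symm
  have hqpos : 0 < q := by
    rcases Nat.eq_zero_or_pos q with h | h
    · subst h
      exact absurd (Subsingleton.elim τ τ') hne'
    · exact h
  -- some element of τ' outside τ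
  obtain ⟨s, hs', hsτ⟩ : ∃ s ∈ τ', s ∉ τ := by
    by_contra! h
    exact hne' (Finset.eq_of_subset_of_card_le h (by omega)).symm
  have hτ : τ = univ.erase s := by
    refine Finset.eq_of_subset_of_card_le (fun x hx => ?_) ?_
    · exact Finset.mem_erase.2 ⟨fun h => hsτ (h ▸ hx), mem_univ _⟩
    · rw [Finset.card_erase_of_mem (mem_univ _), card_univ, Fintype.card_fin, hcard]
  have hs : D s ≤ (univ.erase s).sup D := by
    rw [← hτ, heq']; exact Finset.le_sup hs'
  have hS : univ.erase s ≠ ∅ := by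
    intro h
    rw [h] at hs
    exact hne s (le_antisymm hs bot_le)
  have hq2 : 2 ≤ q := by
    have : 0 < (univ.erase s).card := Finset.card_pos.2 (Finset.nonempty_iff_ne_empty.2 hS)
    rw [Finset.card_erase_of_mem (mem_univ _), card_univ, Fintype.card_fin] at this
    omega
  have hstrict : ∀ (σ : Finset (Fin q)) (j : Fin q), j ∉ σ → ¬ univ.erase s ⊆ insert j σ →
      (insert j σ).sup D ≠ σ.sup D := by
    intro σ j hj hΩ h
    have h1 := hbig σ (insert j σ) (fun h => hj (h ▸ mem_insert_self _ _)) h.symm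
    have h2 : (insert j σ).card = σ.card + 1 := Finset.card_insert_of_notMem hj
    apply hΩ
    have : insert j σ = univ := by
      rw [← Finset.card_eq_iff_eq_univ, Fintype.card_fin]
      have := Finset.card_le_univ (insert j σ)
      rw [Fintype.card_fin] at this
      omega
    rw [this]; exact subset_univ _
  have key : ∀ i, F.rk i = Fintype.card (Idx s i) := by
    intro i
    have := FRes.card_eq maxIdeal_ne_top (ofMin F) (pivotRes D s hs hstrict hS) i
    rw [← Fintype.card_fin (F.rk i)]
    exact this
  refine ⟨fun i hi => ?_, ?_, ?_⟩
  · rw [key, card_idx_lt s i (by omega)]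
  · rw [key, card_idx_eq s hqpos]
  · rw [key, card_idx_top]
end

section
/- Setting σ_0 = ∂ (the differential of the pivot resolution T_{1,…,l}), σ_{e_s} for s ∈ [r] as defined, and σ_u = 0 for every u ∈ ℕ^r with |u| ≥ 2, the family (σ_u)_{u ∈ ℕ^r} is a system of higher homotopies for a_1,…,a_r on T_{1,…,l}. -/
open MvPolynomial Finset

noncomputable section

/-- The index set `[l] = {1,…,l}`, realized as the first `l` elements of `Fin q`. -/
def Lset (q l : ℕ) : Finset (Fin q) :=
  Finset.univ.filter fun i => (i : ℕ) < l

/-- The pivot index `l+1`, realized as the element of `Fin q` with value `l`. -/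
def pivElt (q l : ℕ) (hq : l < q) : Fin q := ⟨l, hq⟩

/-- The unique element `t` of `[l] ∖ A` (when it exists). -/
def tOf (q l : ℕ) (hq : l < q) (A : Finset (Fin q)) : Fin q :=
  if h : (Lset q l \ A).Nonempty then (Lset q l \ A).min' h else pivElt q l hq

/-- The sum `Σ_{j ∈ J} sign(j,A) a_{sj} (m_j m_A / m_{A∪{j}}) ε_{A∪{j}}`,
where `c j = a_{sj}`. -/
def sigTerm (k : Type*) [Field k] (n q : ℕ) (D : Fin q → (Fin n →₀ ℕ))
    (c : Fin q → MvPolynomial (Fin n) k) (A J : Finset (Fin q)) : TotMod k n q :=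
  ∑ j ∈ J, Finsupp.single (insert j A)
    ((fsign {j} A : MvPolynomial (Fin n) k) * c j *
      monomial (D j + A.sup D - (insert j A).sup D) (1 : k))

/-- The correction term
`(−1)^{l+1} sign(t,A) a_{st} Σ_{i∈[l]} sign(i, A∪{t}∖{i})
  (m_t m_A / m_{A∪{t}∪{l+1}∖{i}}) ε_{A∪{t}∪{l+1}∖{i}}`. -/
def sigCorr (k : Type*) [Field k] (n q l : ℕ) (hq : l < q)
    (D : Fin q → (Fin n →₀ ℕ)) (c : Fin q → MvPolynomial (Fin n) k)
    (A : Finset (Fin q)) (t : Fin q) : TotMod k n q :=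
  ∑ i ∈ Lset q l, Finsupp.single ((insert (pivElt q l hq) (insert t A)) \ {i})
    ((-1 : MvPolynomial (Fin n) k) ^ (l + 1) *
      (fsign {t} A : MvPolynomial (Fin n) k) * c t *
      (fsign {i} (insert t A \ {i}) : MvPolynomial (Fin n) k) *
      monomial (D t + A.sup D - ((insert (pivElt q l hq) (insert t A)) \ {i}).sup D)
        (1 : k))

/-- The homotopy `σ_{e_s}` (for coefficients `c j = a_{sj}`), defined on basis
elements `ε_A` by the three-case formula of Theorem 5.1 of the paper. -/
def sigmaMap (k : Type*) [Field k] (n q l : ℕ) (hq : l < q)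
    (D : Fin q → (Fin n →₀ ℕ)) (c : Fin q → MvPolynomial (Fin n) k) :
    TotMod k n q →ₗ[MvPolynomial (Fin n) k] TotMod k n q :=
  Finsupp.linearCombination _ fun A =>
    if (A ∩ Lset q l).card ≠ l - 1 then
      sigTerm k n q D c A Aᶜ
    else if pivElt q l hq ∈ A then
      sigTerm k n q D c A (insert (tOf q l hq A) A)ᶜ
    else
      sigTerm k n q D c A (insert (tOf q l hq A) A)ᶜ +
        sigCorr k n q l hq D c A (tOf q l hq A)

/-- The element `a_s = Σ_{j=1}^q a_{sj} m_j`, for coefficients `c j = a_{sj}`. -/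
def aElt (k : Type*) [Field k] (n q : ℕ) (D : Fin q → (Fin n →₀ ℕ))
    (c : Fin q → MvPolynomial (Fin n) k) : MvPolynomial (Fin n) k :=
  ∑ j : Fin q, c j * monomial (D j) (1 : k)
end

noncomputable section

/-- The full family `σ_u` (`u ∈ ℕ^r`): `σ_0 = ∂`, `σ_{e_s}` as defined, and
`σ_u = 0` for `|u| ≥ 2`. -/
def sysMap (k : Type*) [Field k] (n q l : ℕ) (hq : l < q)
    (D : Fin q → (Fin n →₀ ℕ)) (r : ℕ)
    (a : Fin r → Fin q → MvPolynomial (Fin n) k) (u : Fin r →₀ ℕ) :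
    TotMod k n q →ₗ[MvPolynomial (Fin n) k] TotMod k n q :=
  if u = 0 then taylorD k n q D
  else if (u.sum fun _ m => m) = 1 then ∑ s : Fin r, u s • sigmaMap k n q l hq D (a s)
  else 0

/-- `σ` is a system of higher homotopies for `a_1, …, a_r` on the subcomplex of the
Taylor complex indexed by `Ω`: each `σ_u` raises homological degree by `2|u| − 1`,
`σ_0 = ∂`, `σ_0 σ_{e_s} + σ_{e_s} σ_0` is multiplication by `a_s`, and
`Σ_{b+b'=u} σ_b σ_{b'} = 0` whenever `|u| ≥ 2`. -/
def IsHigherHomotopySystem (k : Type*) [Field k] (n q : ℕ)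
    (D : Fin q → (Fin n →₀ ℕ)) (r : ℕ)
    (a : Fin r → Fin q → MvPolynomial (Fin n) k)
    (Ω : Set (Finset (Fin q)))
    (σ : (Fin r →₀ ℕ) → (TotMod k n q →ₗ[MvPolynomial (Fin n) k] TotMod k n q)) :
    Prop :=
  (∀ x ∈ subcx k n q Ω, σ 0 x = taylorD k n q D x) ∧
  (∀ u : Fin r →₀ ℕ, ∀ i : ℕ, ∀ x ∈ piece k n q Ω i,
      σ u x ∈ piece k n q Ω (i + 2 * (u.sum fun _ m => m) - 1)) ∧
  (∀ s : Fin r, ∀ x ∈ subcx k n q Ω,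
      σ 0 (σ (Finsupp.single s 1) x) + σ (Finsupp.single s 1) (σ 0 x) =
        aElt k n q D (a s) • x) ∧
  (∀ u : Fin r →₀ ℕ, 2 ≤ (u.sum fun _ m => m) → ∀ x ∈ subcx k n q Ω,
      ∑ b ∈ Finset.Iic u, σ b (σ (u - b) x) = 0)

section pivotAux

namespace PivotAux

variable {R : Type*} [CommRing R] {q : ℕ}

/-- sign of `j` relative to `A` -/
def sg (R : Type*) [CommRing R] {q : ℕ} (j : Fin q) (A : Finset (Fin q)) : R :=
  (-1) ^ (A.filter (fun x => x < j)).card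

/-- elementary sign -/
def ep (R : Type*) [CommRing R] {q : ℕ} (i j : Fin q) : R := if i < j then -1 else 1

lemma sg_insert (i j : Fin q) (A : Finset (Fin q)) (h : i ∉ A) :
    sg R j (insert i A) = ep R i j * sg R j A := by
  unfold sg ep
  rw [Finset.filter_insert]
  split_ifs with h1
  · rw [Finset.card_insert_of_notMem (by simp [h]), pow_succ]; ring
  · ring

lemma ep_mul_self (i j : Fin q) : ep R i j * ep R i j = 1 := by
  unfold ep; split_ifs <;> simp

lemma sg_mul_self (j : Fin q) (A : Finset (Fin q)) : sg R j A * sg R j A = 1 := by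
  unfold sg; rw [← mul_pow]; simp

lemma sg_erase (i j : Fin q) (A : Finset (Fin q)) (h : i ∈ A) :
    sg R j (A.erase i) = ep R i j * sg R j A := by
  conv_rhs => rw [← Finset.insert_erase h, sg_insert _ _ _ (Finset.notMem_erase i A)]
  rw [← mul_assoc, ep_mul_self, one_mul]

lemma ep_self (i : Fin q) : ep R i i = 1 := by simp [ep]

lemma ep_swap {i j : Fin q} (h : i ≠ j) : ep R i j = - ep R j i := by
  unfold ep
  rcases lt_or_gt_of_ne h with h1 | h1
  · simp [h1, not_lt.mpr h1.le]
  · simp [h1, not_lt.mpr h1.le]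

/-- basis vector -/
abbrev bas (R : Type*) [CommRing R] {q : ℕ} (A : Finset (Fin q)) : Finset (Fin q) →₀ R :=
  Finsupp.single A 1

/-- creation operator -/
def wj (R : Type*) [CommRing R] {q : ℕ} (j : Fin q) :
    (Finset (Fin q) →₀ R) →ₗ[R] (Finset (Fin q) →₀ R) :=
  Finsupp.linearCombination R fun A => if j ∈ A then 0 else sg R j A • bas R (insert j A)

/-- annihilation operator -/
def dj (R : Type*) [CommRing R] {q : ℕ} (j : Fin q) :
    (Finset (Fin q) →₀ R) →ₗ[R] (Finset (Fin q) →₀ R) :=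
  Finsupp.linearCombination R fun A => if j ∈ A then sg R j A • bas R (A.erase j) else 0

lemma wj_bas (j : Fin q) (A : Finset (Fin q)) :
    wj R j (bas R A) = if j ∈ A then 0 else sg R j A • bas R (insert j A) := by
  simp [wj, Finsupp.linearCombination_single]

lemma dj_bas (j : Fin q) (A : Finset (Fin q)) :
    dj R j (bas R A) = if j ∈ A then sg R j A • bas R (A.erase j) else 0 := by
  simp [dj, Finsupp.linearCombination_single]

lemma ext_bas {f g : (Finset (Fin q) →₀ R) →ₗ[R] (Finset (Fin q) →₀ R)}
    (h : ∀ A, f (bas R A) = g (bas R A)) : f = g :=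
  Finsupp.lhom_ext' fun A => LinearMap.ext_ring (h A)

lemma ww_self (j : Fin q) : wj R j ∘ₗ wj R j = 0 := by
  apply ext_bas; intro A
  by_cases h : j ∈ A <;> simp [wj_bas, h, -Finsupp.smul_single]

lemma dd_self (j : Fin q) : dj R j ∘ₗ dj R j = 0 := by
  apply ext_bas; intro A
  by_cases h : j ∈ A <;> simp [dj_bas, h, -Finsupp.smul_single]

lemma ww_ne {i j : Fin q} (hij : i ≠ j) : wj R i ∘ₗ wj R j = - (wj R j ∘ₗ wj R i) := by
  apply ext_bas; intro A
  have hji := hij.symm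
  by_cases hi : i ∈ A <;> by_cases hj : j ∈ A <;>
    simp [wj_bas, hi, hj, hij, hji, -Finsupp.smul_single]
  rw [sg_insert _ _ _ hi, sg_insert _ _ _ hj, Finset.insert_comm, smul_smul, smul_smul,
    ep_swap hij, ← neg_smul]
  congr 1; ring

lemma dd_ne {i j : Fin q} (hij : i ≠ j) : dj R i ∘ₗ dj R j = - (dj R j ∘ₗ dj R i) := by
  apply ext_bas; intro A
  have hji := hij.symm
  by_cases hi : i ∈ A <;> by_cases hj : j ∈ A <;>
    simp [dj_bas, hi, hj, hij, hji, -Finsupp.smul_single]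
  rw [sg_erase _ _ _ hi, sg_erase _ _ _ hj, Finset.erase_right_comm, smul_smul, smul_smul,
    ep_swap hij, ← neg_smul]
  congr 1; ring

lemma dw_ne {i j : Fin q} (hij : i ≠ j) : dj R i ∘ₗ wj R j = - (wj R j ∘ₗ dj R i) := by
  apply ext_bas; intro A
  have hji := hij.symm
  by_cases hi : i ∈ A <;> by_cases hj : j ∈ A <;>
    simp [dj_bas, wj_bas, hi, hj, hij, hji, -Finsupp.smul_single]
  rw [sg_erase _ _ _ hi, sg_insert _ _ _ hj, Finset.erase_insert_of_ne hji, smul_smul, smul_smul,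
    ep_swap hij, ← neg_smul]
  congr 1; ring

lemma dw_self (i : Fin q) : dj R i ∘ₗ wj R i + wj R i ∘ₗ dj R i = LinearMap.id := by
  apply ext_bas; intro A
  by_cases hi : i ∈ A <;>
    simp [dj_bas, wj_bas, hi, -Finsupp.smul_single]
  · rw [sg_erase _ _ _ hi, ep_self, smul_smul, one_mul, sg_mul_self, one_smul]
  · rw [sg_insert _ _ _ hi, ep_self, smul_smul, one_mul, sg_mul_self, one_smul]

/-- sum of annihilation operators -/
def dS (R : Type*) [CommRing R] {q : ℕ} (S : Finset (Fin q)) :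
    (Finset (Fin q) →₀ R) →ₗ[R] (Finset (Fin q) →₀ R) := ∑ i ∈ S, dj R i

/-- wedge with a vector -/
def wC {q : ℕ} (c : Fin q → R) :
    (Finset (Fin q) →₀ R) →ₗ[R] (Finset (Fin q) →₀ R) := ∑ i, c i • wj R i

lemma dd' (i j : Fin q) (x) : dj R i (dj R j x) = - dj R j (dj R i x) := by
  by_cases h : i = j
  · subst h
    have := LinearMap.congr_fun (dd_self (R := R) i) x
    simp at this; simp [this]
  · exact LinearMap.congr_fun (dd_ne (R := R) h) x

lemma ww' (i j : Fin q) (x) : wj R i (wj R j x) = - wj R j (wj R i x) := by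
  by_cases h : i = j
  · subst h
    have := LinearMap.congr_fun (ww_self (R := R) i) x
    simp at this; simp [this]
  · exact LinearMap.congr_fun (ww_ne (R := R) h) x

lemma dSdS (S T : Finset (Fin q)) (x) : dS R S (dS R T x) = - dS R T (dS R S x) := by
  simp only [dS, LinearMap.sum_apply, map_sum]
  rw [Finset.sum_comm, ← Finset.sum_neg_distrib]
  refine Finset.sum_congr rfl fun i _ => ?_
  rw [← Finset.sum_neg_distrib]
  exact Finset.sum_congr rfl fun j _ => dd' _ _ _

lemma wCwC (c c' : Fin q → R) (x) : wC c (wC c' x) = - wC c' (wC c x) := by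
  simp only [wC, LinearMap.sum_apply, map_sum, LinearMap.smul_apply, map_smul, Finset.smul_sum]
  rw [Finset.sum_comm, ← Finset.sum_neg_distrib]
  refine Finset.sum_congr rfl fun i _ => ?_
  rw [← Finset.sum_neg_distrib]
  refine Finset.sum_congr rfl fun j _ => ?_
  rw [ww', smul_comm, smul_neg, smul_neg]

lemma dSdS_self (S : Finset (Fin q)) (x) : dS R S (dS R S x) = 0 := by
  induction S using Finset.induction_on with
  | empty => simp [dS]
  | insert a s ha ih =>
    have h1 : dS R (insert a s) = dj R a + dS R s := by simp [dS, ha]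
    have h2 := dSdS (R := R) {a} s x
    have h3 := LinearMap.congr_fun (dd_self (R := R) a) x
    simp [dS] at h2 h3
    simp [h1, h3, ih]
    simp [dS, h2]

lemma wCwC_self (c : Fin q → R) (x) : wC c (wC c x) = 0 := by
  have key : ∀ S : Finset (Fin q), ∀ y, (∑ i ∈ S, c i • wj R i) ((∑ i ∈ S, c i • wj R i) y) = 0 := by
    intro S y
    induction S using Finset.induction_on with
    | empty => simp
    | insert a s ha ih =>
      have h3 := LinearMap.congr_fun (ww_self (R := R) a) y
      simp at h3
      rw [Finset.sum_insert ha]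
      rw [LinearMap.add_apply, LinearMap.add_apply, map_add, map_add, ih]
      simp [h3]
      rw [Finset.smul_sum, ← Finset.sum_add_distrib]
      apply Finset.sum_eq_zero
      intro i _
      rw [ww' a i, smul_comm]; simp
  exact key _ x

lemma dSw_mem {S : Finset (Fin q)} {j : Fin q} (h : j ∈ S) (x) :
    dS R S (wj R j x) = x - wj R j (dS R S x) := by
  have h3 := LinearMap.congr_fun (dw_self (R := R) j) x
  simp at h3
  simp only [dS, LinearMap.sum_apply, map_sum]
  rw [← Finset.add_sum_erase _ _ h, ← Finset.add_sum_erase _ (fun i => wj R j (dj R i x)) h]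
  have : ∑ i ∈ S.erase j, dj R i (wj R j x) = - ∑ i ∈ S.erase j, wj R j (dj R i x) := by
    rw [← Finset.sum_neg_distrib]
    refine Finset.sum_congr rfl fun i hi => ?_
    exact LinearMap.congr_fun (dw_ne (R := R) (Finset.ne_of_mem_erase hi)) x
  rw [this]; nth_rw 3 [← h3]; abel

lemma dSw_notMem {S : Finset (Fin q)} {j : Fin q} (h : j ∉ S) (x) :
    dS R S (wj R j x) = - wj R j (dS R S x) := by
  simp only [dS, LinearMap.sum_apply, map_sum]
  rw [← Finset.sum_neg_distrib]
  refine Finset.sum_congr rfl fun i hi => ?_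
  have hij : i ≠ j := fun e => h (e ▸ hi)
  exact LinearMap.congr_fun (dw_ne (R := R) hij) x

lemma dwC (c : Fin q → R) (x) :
    dS R univ (wC c x) + wC c (dS R univ x) = (∑ j, c j) • x := by
  simp only [wC, LinearMap.sum_apply, map_sum, LinearMap.smul_apply, map_smul]
  rw [← Finset.sum_add_distrib, Finset.sum_smul]
  refine Finset.sum_congr rfl fun i _ => ?_
  rw [dSw_mem (Finset.mem_univ i), ← smul_add]; simp

/-- the retraction onto the pivot complex -/
def rho (R : Type*) [CommRing R] {q : ℕ} (L : Finset (Fin q)) (p : Fin q) :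
    (Finset (Fin q) →₀ R) →ₗ[R] (Finset (Fin q) →₀ R) :=
  Finsupp.linearCombination R fun A => if L ⊆ A then wj R p (dS R L (bas R A)) else bas R A

lemma rho_bas (L : Finset (Fin q)) (p : Fin q) (A) : rho R L p (bas R A) =
    if L ⊆ A then wj R p (dS R L (bas R A)) else bas R A := by
  simp [rho]

/-- supported on sets containing / not containing `L` -/
abbrev sup' (R : Type*) [CommRing R] {q : ℕ} (X : Set (Finset (Fin q))) :
    Submodule R (Finset (Fin q) →₀ R) := Finsupp.supported R R X

lemma bas_mem {X : Set (Finset (Fin q))} {A} (h : A ∈ X) : bas R A ∈ sup' R X :=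
  Finsupp.single_mem_supported R 1 h

lemma eqOn_sup {X : Set (Finset (Fin q))}
    {f g : (Finset (Fin q) →₀ R) →ₗ[R] (Finset (Fin q) →₀ R)}
    (h : ∀ A ∈ X, f (bas R A) = g (bas R A)) {x} (hx : x ∈ sup' R X) : f x = g x := by
  rw [sup', Finsupp.supported_eq_span_single] at hx
  refine LinearMap.eqOn_span ?_ hx
  rintro _ ⟨A, hA, rfl⟩
  exact h A hA

lemma map_sup {X : Set (Finset (Fin q))} {N : Submodule R (Finset (Fin q) →₀ R)}
    {f : (Finset (Fin q) →₀ R) →ₗ[R] (Finset (Fin q) →₀ R)}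
    (h : ∀ A ∈ X, f (bas R A) ∈ N) {x} (hx : x ∈ sup' R X) : f x ∈ N := by
  rw [sup', Finsupp.supported_eq_span_single] at hx
  have : Submodule.span R ((fun i => Finsupp.single i (1:R)) '' X) ≤ N.comap f := by
    rw [Submodule.span_le]
    rintro _ ⟨A, hA, rfl⟩
    exact h A hA
  exact this hx

lemma wj_sup {X Y : Set (Finset (Fin q))} (j : Fin q)
    (h : ∀ A ∈ X, j ∉ A → insert j A ∈ Y) {x} (hx : x ∈ sup' R X) : wj R j x ∈ sup' R Y := by
  refine map_sup (fun A hA => ?_) hx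
  rw [wj_bas]; split_ifs with h1
  · exact Submodule.zero_mem _
  · exact Submodule.smul_mem _ _ (bas_mem (h A hA h1))

lemma dS_sup {X Y : Set (Finset (Fin q))} (S : Finset (Fin q))
    (h : ∀ j ∈ S, ∀ A ∈ X, j ∈ A → A.erase j ∈ Y) {x} (hx : x ∈ sup' R X) :
    dS R S x ∈ sup' R Y := by
  refine map_sup (fun A hA => ?_) hx
  simp only [dS, LinearMap.sum_apply]
  refine Submodule.sum_mem _ fun j hj => ?_
  rw [dj_bas]; split_ifs with h1
  · exact Submodule.smul_mem _ _ (bas_mem (h j hj A hA h1))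
  · exact Submodule.zero_mem _

lemma wC_sup {X Y : Set (Finset (Fin q))} (c : Fin q → R)
    (h : ∀ j, ∀ A ∈ X, j ∉ A → insert j A ∈ Y) {x} (hx : x ∈ sup' R X) : wC c x ∈ sup' R Y := by
  simp only [wC, LinearMap.sum_apply]
  exact Submodule.sum_mem _ fun j _ => Submodule.smul_mem _ _ (wj_sup j (h j) hx)

lemma rho_N {L : Finset (Fin q)} {p : Fin q} {x} (hx : x ∈ sup' R {A | ¬ L ⊆ A}) :
    rho R L p x = x := by
  refine eqOn_sup (f := rho R L p) (g := LinearMap.id) (fun A hA => ?_) hx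
  rw [rho_bas, if_neg (show ¬ L ⊆ A from hA)]; rfl

lemma rho_S {L : Finset (Fin q)} {p : Fin q} {x} (hx : x ∈ sup' R {A | L ⊆ A}) :
    rho R L p x = wj R p (dS R L x) := by
  refine eqOn_sup (f := rho R L p) (g := wj R p ∘ₗ dS R L) (fun A hA => ?_) hx
  rw [rho_bas, if_pos (show L ⊆ A from hA)]; rfl

lemma wd_N {L : Finset (Fin q)} {p : Fin q} (hp : p ∉ L) {x} (hx : x ∈ sup' R {A | L ⊆ A}) :
    wj R p (dS R L x) ∈ sup' R {A | ¬ L ⊆ A} := by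
  refine wj_sup (X := {A | ¬ L ⊆ A}) p (fun A hA _ => ?_) (dS_sup L (fun j hj A hA hjA => ?_) hx)
  · exact fun h => hA ((Finset.subset_insert_iff_of_notMem hp).1 h)
  · exact fun h => Finset.notMem_erase j A (h hj)

lemma rho_w_rho {L : Finset (Fin q)} {p : Fin q} (hp : p ∉ L) (c : Fin q → R) (x) :
    rho R L p (wC c (rho R L p x)) = rho R L p (wC c x) := by
  suffices h : ∀ j, rho R L p ∘ₗ wj R j ∘ₗ rho R L p = rho R L p ∘ₗ wj R j by
    simp only [wC, LinearMap.sum_apply, map_sum, LinearMap.smul_apply, map_smul]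
    refine Finset.sum_congr rfl fun j _ => ?_
    congr 1
    exact LinearMap.congr_fun (h j) x
  intro j
  apply ext_bas; intro A
  by_cases hA : L ⊆ A
  · have hS : bas R A ∈ sup' R {A | L ⊆ A} := bas_mem hA
    have hw : ∀ j, ∀ y ∈ sup' R {A | L ⊆ A}, wj R j y ∈ sup' R {A | L ⊆ A} := fun j y hy =>
      wj_sup j (fun A hA _ => Finset.Subset.trans hA (Finset.subset_insert _ _)) hy
    have hpp : ∀ y, wj R p (wj R p y) = 0 := fun y => LinearMap.congr_fun (ww_self (R := R) p) y
    simp only [LinearMap.comp_apply]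
    rw [rho_S hS, rho_S (hw j _ hS)]
    by_cases hj : j ∈ L
    · have h0 : wj R j (bas R A) = 0 := by rw [wj_bas, if_pos (hA hj)]
      have h1 := dSw_mem (R := R) hj (bas R A)
      rw [h0, map_zero] at h1
      rw [ww', ← sub_eq_zero.1 h1.symm, h0, map_neg, rho_S (hw p _ hS), dSw_notMem hp, map_neg,
        hpp]
      simp
    · rw [ww', ← map_neg, ← dSw_notMem hj, rho_N (wd_N hp (hw j _ hS))]
  · simp only [LinearMap.comp_apply]
    rw [rho_N (x := bas R A) (bas_mem hA)]

lemma d_rho {L : Finset (Fin q)} {p : Fin q} (x) :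
    dS R univ (rho R L p x) = rho R L p (dS R univ x) := by
  suffices h : dS R univ ∘ₗ rho R L p = rho R L p ∘ₗ dS R univ from LinearMap.congr_fun h x
  apply ext_bas; intro A
  simp only [LinearMap.comp_apply]
  by_cases hA : L ⊆ A
  · have hS : bas R A ∈ sup' R {A | L ⊆ A} := bas_mem hA
    have hsplit : ∀ y, dS R univ y = dS R L y + dS R Lᶜ y := fun y => by
      simp only [dS, LinearMap.sum_apply]
      exact (Finset.sum_add_sum_compl L _).symm
    have h1 : dS R L (bas R A) ∈ sup' R {A | ¬ L ⊆ A} :=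
      dS_sup (X := {A | L ⊆ A}) (Y := {A | ¬ L ⊆ A}) L
        (fun j hj A hA hjA h => Finset.notMem_erase j A (h hj)) hS
    have h2 : dS R Lᶜ (bas R A) ∈ sup' R {A | L ⊆ A} :=
      dS_sup Lᶜ (fun j hj A hA hjA => Finset.subset_erase.2 ⟨hA, Finset.mem_compl.1 hj⟩) hS
    rw [rho_S hS, dSw_mem (Finset.mem_univ p), hsplit (dS R L _), dSdS_self, zero_add,
      hsplit (bas R A), map_add, rho_N h1, rho_S h2, dSdS Lᶜ L, map_neg, sub_neg_eq_add]
  · rw [rho_N (x := bas R A) (bas_mem hA), rho_N]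
    exact dS_sup (X := {A | ¬ L ⊆ A}) (Y := {A | ¬ L ⊆ A}) _
      (fun j _ A hA _ h => hA (Finset.Subset.trans h (Finset.erase_subset _ _)))
      (bas_mem hA)

lemma fsign_eq {j : Fin q} {B : Finset (Fin q)} (h : j ∉ B) : ((fsign {j} B : ℤ) : R) = sg R j B := by
  unfold fsign sg
  rw [if_pos (Finset.singleton_inter_of_notMem h)]
  have : ((({j} : Finset (Fin q)) ×ˢ B).filter fun p => p.2 < p.1).card
      = (B.filter (fun x => x < j)).card := by
    rw [Finset.singleton_product, Finset.filter_map, Finset.card_map]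
    rfl
  rw [this]; push_cast; rfl

lemma fsign_zero {j : Fin q} {B : Finset (Fin q)} (h : j ∈ B) : fsign {j} B = 0 := by
  unfold fsign
  rw [if_neg]
  rw [Finset.singleton_inter_of_mem h]
  exact Finset.singleton_ne_empty j

variable {k : Type*} [Field k] {n l : ℕ}

/-- rescaling -/
def phi (k : Type*) [Field k] {n q : ℕ} (D : Fin q → (Fin n →₀ ℕ)) :
    TotMod k n q →ₗ[MvPolynomial (Fin n) k] TotMod k n q :=
  Finsupp.linearCombination _ fun A => (monomial (A.sup D) (1 : k)) • bas _ A

lemma phi_single (D : Fin q → (Fin n →₀ ℕ)) (A) (r : MvPolynomial (Fin n) k) :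
    phi k D (Finsupp.single A r) = (r * monomial (A.sup D) (1 : k)) • bas _ A := by
  simp only [phi, Finsupp.linearCombination_single, smul_smul]

lemma phi_apply (D : Fin q → (Fin n →₀ ℕ)) (x : TotMod k n q) (A) :
    phi k D x A = x A * monomial (A.sup D) (1 : k) := by
  induction x using Finsupp.induction_linear with
  | zero => simp
  | add f g hf hg => rw [map_add, Finsupp.add_apply, hf, hg, Finsupp.add_apply, add_mul]
  | single B r =>
    rw [phi_single]
    by_cases h : B = A
    · subst h; simp
    · simp [h]

lemma phi_apply_eq_zero (D : Fin q → (Fin n →₀ ℕ)) (x : TotMod k n q) (A) :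
    phi k D x A = 0 ↔ x A = 0 := by
  rw [phi_apply, mul_eq_zero]
  simp

lemma phi_inj (D : Fin q → (Fin n →₀ ℕ)) : Function.Injective (phi k D) := by
  rw [injective_iff_map_eq_zero]
  intro x hx
  ext1 A
  exact (phi_apply_eq_zero D x A).1 (by rw [hx]; rfl)

lemma phi_sup (D : Fin q → (Fin n →₀ ℕ)) (X) (x : TotMod k n q) :
    phi k D x ∈ sup' _ X ↔ x ∈ sup' _ X := by
  simp only [sup', Finsupp.mem_supported']
  exact forall₂_congr fun A _ => phi_apply_eq_zero D x A

lemma mono_cancel {a b : Fin n →₀ ℕ} (h : b ≤ a) :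
    (monomial (a - b) (1 : k)) * monomial b 1 = monomial a 1 := by
  rw [monomial_mul, tsub_add_cancel_of_le h, one_mul]

lemma phi_taylor (D : Fin q → (Fin n →₀ ℕ)) (x : TotMod k n q) :
    phi k D (taylorD k n q D x) = dS _ univ (phi k D x) := by
  suffices h : phi k D ∘ₗ taylorD k n q D = dS _ univ ∘ₗ phi k D from LinearMap.congr_fun h x
  apply ext_bas; intro A
  simp only [LinearMap.comp_apply]
  rw [phi_single, one_mul, map_smul, taylorD, Finsupp.linearCombination_single, one_smul, map_sum]
  simp only [dS, LinearMap.sum_apply, dj_bas]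
  rw [← Finset.sum_filter, Finset.smul_sum, Finset.filter_mem_eq_inter, Finset.univ_inter]
  refine Finset.sum_congr rfl fun j hj => ?_
  rw [phi_single, fsign_eq (by simp), smul_smul, Finset.sdiff_singleton_eq_erase, mul_assoc,
    mono_cancel (Finset.sup_mono (Finset.erase_subset _ _)), sg_erase _ _ _ hj, ep_self, one_mul,
    mul_comm]

lemma phi_sigTerm (D : Fin q → (Fin n →₀ ℕ)) (c : Fin q → MvPolynomial (Fin n) k)
    (A J : Finset (Fin q)) :
    phi k D (sigTerm k n q D c A J) =
      ∑ j ∈ J, (c j * monomial (D j) (1 : k)) • wj _ j (phi k D (bas _ A)) := by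
  rw [sigTerm, map_sum]
  refine Finset.sum_congr rfl fun j _ => ?_
  rw [phi_single, phi_single, one_mul, map_smul, wj_bas]
  split_ifs with h
  · simp [fsign_zero h]
  · have h1 : (insert j A).sup D ≤ D j + A.sup D := by
      rw [Finset.sup_insert]
      exact sup_le le_self_add le_add_self
    rw [fsign_eq h, smul_smul, smul_smul, mul_assoc, mono_cancel h1]
    congr 1
    have : monomial (D j + A.sup D) (1 : k) = monomial (D j) 1 * monomial (A.sup D) 1 := by
      rw [monomial_mul, one_mul]
    rw [this]; ring

lemma card_Lset (hq : l < q) : (Lset q l).card = l := by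
  have : Lset q l = Finset.Iio (⟨l, hq⟩ : Fin q) := by
    ext i; simp [Lset, Fin.lt_def]
  rw [this, Fin.card_Iio]

lemma piv_notMem (hq : l < q) : pivElt q l hq ∉ Lset q l := by
  simp [Lset, pivElt]

lemma phi_sigCorr (hl : 2 ≤ l) (hq : l < q) (D : Fin q → (Fin n →₀ ℕ))
    (hgap : D (pivElt q l hq) ≤ (Lset q l).sup D)
    (c : Fin q → MvPolynomial (Fin n) k)
    (A : Finset (Fin q)) (t : Fin q) (ht : t ∉ A) (hp : pivElt q l hq ∉ A)
    (hL : Lset q l ⊆ insert t A) (htL : t ∈ Lset q l) :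
    phi k D (sigCorr k n q l hq D c A t) =
      (c t * monomial (D t) (1 : k)) •
        rho _ (Lset q l) (pivElt q l hq) (wj _ t (phi k D (bas _ A))) := by
  have hpt : pivElt q l hq ∉ insert t A := by
    rw [Finset.mem_insert]; rintro (h | h)
    · exact piv_notMem hq (h ▸ htL)
    · exact hp h
  rw [phi_single, one_mul, map_smul, wj_bas, if_neg ht, map_smul, map_smul, rho_bas, if_pos hL, dS,
    LinearMap.sum_apply, map_sum, sigCorr, map_sum, Finset.smul_sum, Finset.smul_sum,
    Finset.smul_sum]
  refine Finset.sum_congr rfl fun i hi => ?_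
  have hip : pivElt q l hq ≠ i := fun h => piv_notMem hq (h ▸ hi)
  have hset : insert (pivElt q l hq) (insert t A) \ {i} =
      insert (pivElt q l hq) ((insert t A).erase i) := by
    rw [Finset.sdiff_singleton_eq_erase, Finset.erase_insert_of_ne hip]
  have hle : (insert (pivElt q l hq) ((insert t A).erase i)).sup D ≤ D t + A.sup D := by
    have h1 : (insert t A).sup D ≤ D t + A.sup D := by
      rw [Finset.sup_insert]
      exact sup_le le_self_add le_add_self
    rw [Finset.sup_insert]
    refine sup_le (hgap.trans ((Finset.sup_mono hL).trans h1)) ?_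
    exact (Finset.sup_mono (Finset.erase_subset _ _)).trans h1
  have hsg : sg (MvPolynomial (Fin n) k) (pivElt q l hq) ((insert t A).erase i) =
      (-1) ^ (l + 1) := by
    have : ((insert t A).erase i).filter (fun x => x < pivElt q l hq) = (Lset q l).erase i := by
      ext x
      have hx : x < pivElt q l hq ↔ x ∈ Lset q l := by simp [Lset, pivElt, Fin.lt_def]
      rw [Finset.mem_filter, Finset.mem_erase, Finset.mem_erase, hx]
      constructor
      · rintro ⟨⟨h1, _⟩, h2⟩; exact ⟨h1, h2⟩
      · rintro ⟨h1, h2⟩; exact ⟨⟨h1, hL h2⟩, h2⟩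
    rw [sg, this, Finset.card_erase_of_mem hi, card_Lset hq]
    obtain ⟨m, rfl⟩ : ∃ m, l = m + 1 := ⟨l - 1, by omega⟩
    simp [pow_succ]
  rw [hset, phi_single, dj_bas, if_pos (hL hi), map_smul, wj_bas, if_neg (fun h => hpt (Finset.mem_of_mem_erase h)),
    hsg, fsign_eq ht, Finset.sdiff_singleton_eq_erase, fsign_eq (Finset.notMem_erase _ _), sg_erase _ _ _ (hL hi), ep_self, one_mul,
    mul_assoc, mono_cancel hle]
  simp only [smul_smul]
  congr 1
  have : monomial (D t + A.sup D) (1 : k) = monomial (D t) 1 * monomial (A.sup D) 1 := by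
    rw [monomial_mul, one_mul]
  rw [this]; ring

lemma rho_w_zero {L A : Finset (Fin q)} {p t : Fin q} (hp : p ∉ L) (ht : t ∉ A) (hpA : p ∈ A)
    (hL : L ⊆ insert t A) : rho R L p (wj R t (bas R A)) = 0 := by
  have h0 : wj R p (bas R (insert t A)) = 0 := by
    rw [wj_bas, if_pos (Finset.mem_insert_of_mem hpA)]
  have h1 := dSw_notMem hp (bas R (insert t A))
  rw [h0, map_zero] at h1
  rw [wj_bas, if_neg ht, map_smul, rho_bas, if_pos hL, neg_eq_zero.1 h1.symm, smul_zero]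

set_option maxHeartbeats 1000000 in
lemma phi_sigma (hl : 2 ≤ l) (hq : l < q) (D : Fin q → (Fin n →₀ ℕ))
    (hgap : D (pivElt q l hq) ≤ (Lset q l).sup D)
    (c : Fin q → MvPolynomial (Fin n) k) {x : TotMod k n q}
    (hx : x ∈ sup' _ {A | ¬ Lset q l ⊆ A}) :
    phi k D (sigmaMap k n q l hq D c x) =
      rho _ (Lset q l) (pivElt q l hq)
        (wC (fun j => c j * monomial (D j) (1 : k)) (phi k D x)) := by
  refine eqOn_sup (f := phi k D ∘ₗ sigmaMap k n q l hq D c)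
    (g := rho _ (Lset q l) (pivElt q l hq) ∘ₗ
        wC (fun j => c j * monomial (D j) (1 : k)) ∘ₗ phi k D) (fun A hA => ?_) hx
  have hA : ¬ Lset q l ⊆ A := hA
  simp only [LinearMap.comp_apply]
  rw [sigmaMap, Finsupp.linearCombination_single, one_smul]
  simp only [wC, LinearMap.sum_apply, LinearMap.smul_apply, map_sum, map_smul]
  have hzero : ∀ j ∈ A, wj _ j (phi k D (bas _ A)) = 0 := by
    intro j hj
    rw [phi_single, map_smul, wj_bas, if_pos hj, smul_zero]
  have hN : ∀ j, ¬ Lset q l ⊆ insert j A →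
      rho _ (Lset q l) (pivElt q l hq) (wj _ j (phi k D (bas _ A))) =
        wj _ j (phi k D (bas _ A)) := by
    intro j hj
    apply rho_N
    rw [phi_single, map_smul, wj_bas]
    refine Submodule.smul_mem _ _ ?_
    split_ifs
    · exact Submodule.zero_mem _
    · exact Submodule.smul_mem _ _ (bas_mem hj)
  have hcard : (Lset q l \ A).card + (A ∩ Lset q l).card = l := by
    rw [Finset.inter_comm, Finset.card_sdiff_add_card_inter, card_Lset hq]
  split_ifs with h1 h2
  · rw [phi_sigTerm, ← Finset.sum_subset (Finset.subset_univ Aᶜ)]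
    · refine Finset.sum_congr rfl fun j _ => ?_
      rw [hN]
      intro h
      have hs : Lset q l \ A ⊆ {j} := by
        intro i hi
        rw [Finset.mem_sdiff] at hi
        have := h hi.1
        rw [Finset.mem_insert] at this
        simpa [hi.2] using this
      have h3 := Finset.card_le_card hs
      have h4 : 0 < (Lset q l \ A).card := by
        rw [Finset.card_pos, Finset.sdiff_nonempty]; exact hA
      simp at h3
      omega
    · intro j _ hj
      rw [hzero j (by simpa using hj), map_zero, smul_zero]
  all_goals
    have hne : (Lset q l \ A).Nonempty := by rw [Finset.sdiff_nonempty]; exact hA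
    have h1 : (Lset q l \ A).card = 1 := by omega
    have ht : tOf q l hq A ∈ Lset q l \ A := by
      rw [tOf, dif_pos hne]; exact Finset.min'_mem _ _
    generalize tOf q l hq A = t at *
    have hLA : Lset q l \ A = {t} := by
      obtain ⟨s, hs⟩ := Finset.card_eq_one.1 h1
      rw [hs] at ht ⊢; rw [Finset.mem_singleton.1 ht]
    rw [Finset.mem_sdiff] at ht
    have hL : Lset q l ⊆ insert t A := by
      intro i hi
      by_cases hiA : i ∈ A
      · exact Finset.mem_insert_of_mem hiA
      · have : i ∈ Lset q l \ A := Finset.mem_sdiff.2 ⟨hi, hiA⟩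
        rw [hLA] at this
        rw [Finset.mem_singleton.1 this]; exact Finset.mem_insert_self _ _
    have hsum : ∑ j, (c j * monomial (D j) (1 : k)) •
          rho _ (Lset q l) (pivElt q l hq) (wj _ j (phi k D (bas _ A))) =
        phi k D (sigTerm k n q D c A (insert t A)ᶜ) + (c t * monomial (D t) (1 : k)) •
          rho _ (Lset q l) (pivElt q l hq) (wj _ t (phi k D (bas _ A))) := by
      have e1 : ∑ j ∈ (insert t A)ᶜ, (c j * monomial (D j) (1 : k)) •
          rho _ (Lset q l) (pivElt q l hq) (wj _ j (phi k D (bas _ A))) =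
          phi k D (sigTerm k n q D c A (insert t A)ᶜ) := by
        rw [phi_sigTerm]
        refine Finset.sum_congr rfl fun j hj => ?_
        rw [hN]
        intro h
        have := h ht.1
        rw [Finset.mem_insert] at this
        rcases this with h | h
        · subst h; simp at hj
        · exact ht.2 h
      have e2 : ∑ j ∈ A, (c j * monomial (D j) (1 : k)) •
          rho _ (Lset q l) (pivElt q l hq) (wj _ j (phi k D (bas _ A))) = 0 := by
        refine Finset.sum_eq_zero fun j hj => ?_
        rw [hzero j hj, map_zero, smul_zero]
      rw [← e1, ← Finset.sum_compl_add_sum (insert t A), Finset.sum_insert ht.2, e2, add_zero]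
    rw [hsum]
  · have : rho _ (Lset q l) (pivElt q l hq) (wj _ t (phi k D (bas _ A))) = 0 := by
      rw [phi_single, map_smul, map_smul, rho_w_zero (piv_notMem hq) ht.2 h2 hL, smul_zero]
    rw [this, smul_zero, add_zero]
  · rw [map_add, phi_sigCorr hl hq D hgap c A t ht.2 h2 hL ht.1]

lemma wC_sum {ι : Type*} [Fintype ι] (v : ι → ℕ) (c : ι → Fin q → R) (x) :
    wC (fun j => ∑ s, v s • c s j) x = ∑ s, v s • wC (c s) x := by
  simp only [wC, LinearMap.sum_apply, LinearMap.smul_apply, Finset.sum_smul, Finset.smul_sum]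
  rw [Finset.sum_comm]
  refine Finset.sum_congr rfl fun s _ => Finset.sum_congr rfl fun j _ => ?_
  rw [smul_assoc]

lemma rho_deg {L : Finset (Fin q)} {p : Fin q} (hp : p ∉ L) (i : ℕ) {x}
    (hx : x ∈ sup' R {A | A.card = i}) :
    rho R L p x ∈ sup' R {A | A ∈ pivotΩ L ∧ A.card = i} := by
  refine map_sup (fun A hA => ?_) hx
  have hA : A.card = i := hA
  rw [rho_bas]
  split_ifs with h
  · have h1 : bas R A ∈ sup' R {A | L ⊆ A ∧ A.card = i} := bas_mem ⟨h, hA⟩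
    refine wj_sup (X := {A | ¬ L ⊆ A ∧ A.card + 1 = i}) p (fun B hB hpB => ?_)
      (dS_sup L (fun j hj B hB hjB => ?_) h1)
    · exact ⟨fun h => hB.1 ((Finset.subset_insert_iff_of_notMem hp).1 h),
        by rw [Finset.card_insert_of_notMem hpB]; exact hB.2⟩
    · exact ⟨fun h => Finset.notMem_erase j B (h hj),
        by rw [Finset.card_erase_add_one hjB]; exact hB.2⟩
  · exact bas_mem ⟨h, hA⟩

lemma rho_mem {L : Finset (Fin q)} {p : Fin q} (hp : p ∉ L) (x) :
    rho R L p x ∈ sup' R {A | ¬ L ⊆ A} := by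
  have hx : x ∈ sup' R Set.univ := by simp [sup']
  refine map_sup (fun A _ => ?_) hx
  rw [rho_bas]
  split_ifs with h
  · exact wd_N hp (bas_mem h)
  · exact bas_mem h

lemma phi_sys (hl : 2 ≤ l) (hq : l < q) (D : Fin q → (Fin n →₀ ℕ))
    (hgap : D (pivElt q l hq) ≤ (Lset q l).sup D) (r : ℕ)
    (a : Fin r → Fin q → MvPolynomial (Fin n) k) (u : Fin r →₀ ℕ)
    (hu : (u.sum fun _ m => m) = 1) {x : TotMod k n q}
    (hx : x ∈ sup' _ {A | ¬ Lset q l ⊆ A}) :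
    phi k D (sysMap k n q l hq D r a u x) =
      rho _ (Lset q l) (pivElt q l hq)
        (wC (fun j => ∑ s, u s • (a s j * monomial (D j) (1 : k))) (phi k D x)) := by
  have h0 : u ≠ 0 := by rintro rfl; simp at hu
  rw [sysMap, if_neg h0, if_pos hu, wC_sum (R := MvPolynomial (Fin n) k) (fun s => u s)
    (fun s j => a s j * monomial (D j) (1 : k))]
  simp only [LinearMap.sum_apply, LinearMap.smul_apply, map_sum, map_nsmul]
  refine Finset.sum_congr rfl fun s _ => ?_
  rw [phi_sigma hl hq D hgap (a s) hx]

lemma sys_mem (hl : 2 ≤ l) (hq : l < q) (D : Fin q → (Fin n →₀ ℕ))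
    (hgap : D (pivElt q l hq) ≤ (Lset q l).sup D) (r : ℕ)
    (a : Fin r → Fin q → MvPolynomial (Fin n) k) (u : Fin r →₀ ℕ)
    (hu : (u.sum fun _ m => m) = 1) {x : TotMod k n q}
    (hx : x ∈ sup' _ {A | ¬ Lset q l ⊆ A}) :
    sysMap k n q l hq D r a u x ∈ sup' _ {A | ¬ Lset q l ⊆ A} := by
  rw [← phi_sup D, phi_sys hl hq D hgap r a u hu hx]
  exact rho_mem (piv_notMem hq) _

lemma phi_sys_sys (hl : 2 ≤ l) (hq : l < q) (D : Fin q → (Fin n →₀ ℕ))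
    (hgap : D (pivElt q l hq) ≤ (Lset q l).sup D) (r : ℕ)
    (a : Fin r → Fin q → MvPolynomial (Fin n) k) (u v : Fin r →₀ ℕ)
    (hu : (u.sum fun _ m => m) = 1) (hv : (v.sum fun _ m => m) = 1) {x : TotMod k n q}
    (hx : x ∈ sup' _ {A | ¬ Lset q l ⊆ A}) :
    phi k D (sysMap k n q l hq D r a u (sysMap k n q l hq D r a v x)) =
      rho _ (Lset q l) (pivElt q l hq)
        (wC (fun j => ∑ s, u s • (a s j * monomial (D j) (1 : k)))
        (wC (fun j => ∑ s, v s • (a s j * monomial (D j) (1 : k))) (phi k D x))) := by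
  rw [phi_sys hl hq D hgap r a u hu (sys_mem hl hq D hgap r a v hv hx),
    phi_sys hl hq D hgap r a v hv hx, rho_w_rho (piv_notMem hq)]

lemma sys_big (hq : l < q) (D : Fin q → (Fin n →₀ ℕ)) (r : ℕ)
    (a : Fin r → Fin q → MvPolynomial (Fin n) k) (u : Fin r →₀ ℕ)
    (hu : 2 ≤ (u.sum fun _ m => m)) : sysMap k n q l hq D r a u = 0 := by
  have h0 : u ≠ 0 := by rintro rfl; simp at hu
  rw [sysMap, if_neg h0, if_neg (by omega)]

lemma deg_add {r : ℕ} (u v : Fin r →₀ ℕ) :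
    ((u + v).sum fun _ m => m) = (u.sum fun _ m => m) + (v.sum fun _ m => m) :=
  Finsupp.sum_add_index' (fun _ => rfl) (fun _ _ _ => rfl)

lemma deg_zero {r : ℕ} (u : Fin r →₀ ℕ) (h : (u.sum fun _ m => m) = 0) : u = 0 := by
  ext i
  by_contra hi
  rw [Finsupp.sum, Finset.sum_eq_zero_iff] at h
  exact hi (h i (Finsupp.mem_support_iff.2 hi))

theorem main (hl : 2 ≤ l) (hq : l < q) (D : Fin q → (Fin n →₀ ℕ))
    (hgap : D (pivElt q l hq) ≤ (Lset q l).sup D) (r : ℕ)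
    (a : Fin r → Fin q → MvPolynomial (Fin n) k) :
    IsHigherHomotopySystem k n q D r a (pivotΩ (Lset q l))
      (sysMap k n q l hq D r a) := by
  have hs0 : sysMap k n q l hq D r a 0 = taylorD k n q D := by simp [sysMap]
  have hpiv := piv_notMem hq
  refine ⟨fun x _ => by rw [hs0], fun u i x hx => ?_, fun s x hx => ?_, fun u hu x hx => ?_⟩
  · have hx : x ∈ sup' _ {A | A ∈ pivotΩ (Lset q l) ∧ A.card = i} := hx
    change _ ∈ sup' _ {A | A ∈ pivotΩ (Lset q l) ∧ A.card = _}
    rcases Nat.lt_or_ge 1 (u.sum fun _ m => m) with h2 | h2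
    · rw [sys_big hq D r a u h2]; exact Submodule.zero_mem _
    rcases Nat.lt_or_ge (u.sum fun _ m => m) 1 with h1 | h1
    · have hu0 := deg_zero u (by omega)
      subst hu0
      rw [hs0, ← phi_sup D, phi_taylor]
      refine dS_sup _ (fun j _ A hA hj => ?_) ((phi_sup D _ _).2 hx)
      refine ⟨fun h => hA.1 (Finset.Subset.trans h (Finset.erase_subset _ _)), ?_⟩
      rw [Finset.card_erase_of_mem hj, hA.2]; simp
    · have h1 : (u.sum fun _ m => m) = 1 := by omega
      have hx' : x ∈ sup' _ {A | ¬ Lset q l ⊆ A} :=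
        Finsupp.supported_mono (fun A hA => hA.1) hx
      rw [h1, ← phi_sup D, phi_sys hl hq D hgap r a u h1 hx']
      refine rho_deg hpiv _ (wC_sup _ (fun j A hA hj => ?_) ((phi_sup D _ _).2 hx))
      change (insert j A).card = _
      rw [Finset.card_insert_of_notMem hj, hA.2]; omega
  · have hx : x ∈ sup' _ {A | ¬ Lset q l ⊆ A} := hx
    have hdeg : ((Finsupp.single s 1 : Fin r →₀ ℕ).sum fun _ m => m) = 1 := by simp
    have hdx : taylorD k n q D x ∈ sup' _ {A | ¬ Lset q l ⊆ A} := by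
      rw [← phi_sup D, phi_taylor]
      exact dS_sup (X := {A | ¬ Lset q l ⊆ A}) (Y := {A | ¬ Lset q l ⊆ A}) _
        (fun j _ A hA hj h => hA (Finset.Subset.trans h (Finset.erase_subset _ _)))
        ((phi_sup D _ _).2 hx)
    apply phi_inj D
    rw [hs0, map_add, phi_taylor, phi_sys hl hq D hgap r a _ hdeg hx,
      phi_sys hl hq D hgap r a _ hdeg hdx, phi_taylor, d_rho, ← map_add, dwC, map_smul, map_smul,
      rho_N ((phi_sup D _ _).2 hx)]
    congr 1
    rw [aElt]
    refine Finset.sum_congr rfl fun j _ => ?_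
    rw [Finset.sum_eq_single s]
    · simp
    · intro b _ hb; simp [hb.symm]
    · simp
  · have hx : x ∈ sup' _ {A | ¬ Lset q l ⊆ A} := hx
    have hsplit : ∀ b ∈ Finset.Iic u, (u.sum fun _ m => m) =
        (b.sum fun _ m => m) + ((u - b).sum fun _ m => m) := by
      intro b hb
      rw [← deg_add, add_tsub_cancel_of_le (Finset.mem_Iic.1 hb)]
    have hz : ∀ b ∈ Finset.Iic u, ¬ ((b.sum fun _ m => m) = 1 ∧ ((u - b).sum fun _ m => m) = 1) →
        sysMap k n q l hq D r a b (sysMap k n q l hq D r a (u - b) x) = 0 := by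
      intro b hb h
      have h1 := hsplit b hb
      rcases Nat.lt_or_ge 1 (b.sum fun _ m => m) with h2 | h2
      · rw [sys_big hq D r a b h2]; rfl
      · rw [sys_big hq D r a (u - b) (by omega)]; simp
    have hinv : ∀ b ∈ Finset.Iic u, u - (u - b) = b := fun b hb =>
      tsub_tsub_cancel_of_le (Finset.mem_Iic.1 hb)
    refine Finset.sum_involution (fun b _ => u - b) (fun b hb => ?_) (fun b hb hne he => ?_)
      (fun b hb => Finset.mem_Iic.2 tsub_le_self) (fun b hb => hinv b hb)
    · by_cases h : (b.sum fun _ m => m) = 1 ∧ ((u - b).sum fun _ m => m) = 1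
      · apply phi_inj D
        rw [hinv b hb, map_add, phi_sys_sys hl hq D hgap r a b (u - b) h.1 h.2 hx,
          phi_sys_sys hl hq D hgap r a (u - b) b h.2 h.1 hx, wCwC, map_neg, map_zero,
          neg_add_cancel]
      · rw [hz b hb h, hz (u - b) (Finset.mem_Iic.2 tsub_le_self)
          (by rw [hinv b hb]; tauto), add_zero]
    · apply hne
      by_cases h : (b.sum fun _ m => m) = 1 ∧ ((u - b).sum fun _ m => m) = 1
      · apply phi_inj D
        rw [he, phi_sys_sys hl hq D hgap r a b b h.1 h.1 hx, wCwC_self, map_zero, map_zero]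
      · exact hz b hb h

end PivotAux

end pivotAux

/-- **A system of higher homotopies on pivot resolutions.**
With `l := scarf`, `l ≥ 2`, `l + 1 ≤ q`, `l+1` a gap of `[l]` (so that `T_{1,…,l}`
is a pivot resolution of `Q/I`), and `a_s = Σ_j a_{sj} m_j ∈ I`: setting `σ_0 = ∂`,
`σ_{e_s}` as in the explicit formula, and `σ_u = 0` for `|u| ≥ 2` yields a system
of higher homotopies for `a_1, …, a_r` on `T_{1,…,l}`. -/
theorem sysMap_isHigherHomotopySystem {k : Type*} [Field k] {n q l : ℕ}
    (hl : 2 ≤ l) (hq : l < q)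
    (D : Fin q → (Fin n →₀ ℕ))
    (hne : ∀ i : Fin q, D i ≠ 0)
    (hmin : ∀ i j : Fin q, i ≠ j → ¬ lcmMono k n q D {i} ∣ lcmMono k n q D {j})
    (hgap : lcmMono k n q D {pivElt q l hq} ∣ lcmMono k n q D (Lset q l))
    (r : ℕ) (a : Fin r → Fin q → MvPolynomial (Fin n) k) :
    IsHigherHomotopySystem k n q D r a (pivotΩ (Lset q l))
      (sysMap k n q l hq D r a) := by
  refine PivotAux.main hl hq D ?_ r a
  have h := monomial_one_dvd_monomial_one.1 hgap
  simpa using h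

end
end
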